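/- arXiv:math/0605349 — 6 statements merged into one kernel-verified Lean document; each statement's English description precedes it below -/
import Mathlib

section
/- Let Δ = (a₁,b₁)×(a₂,b₂) ⊂ ℝ² be a square of sidelength δ and let f be a complex-valued C² function on a neighborhood of the closure of Δ. Then for every (x₁,x₂) ∈ Δ, |f(x₁,x₂)|² ≤ 4( δ⁻² ∫_Δ |f|² dA + ∫_Δ |X₁ f|² dA + ∫_Δ |X₂ f|² dA + δ² ∫_Δ |X₂X₁ f|² dA ). -/
open MeasureTheory Complex

noncomputable section

/-- Partial derivative in the `x₁` (real-axis) direction. -/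
def pd₁ (f : ℂ → ℂ) (z : ℂ) : ℂ := fderiv ℝ f z 1

/-- Partial derivative in the `x₂` (imaginary-axis) direction. -/
def pd₂ (f : ℂ → ℂ) (z : ℂ) : ℂ := fderiv ℝ f z Complex.I

/-- Partial derivative in the `x₁` direction of a real-valued function. -/
def pdR₁ (p : ℂ → ℝ) (z : ℂ) : ℝ := fderiv ℝ p z 1

/-- Partial derivative in the `x₂` direction of a real-valued function. -/
def pdR₂ (p : ℂ → ℝ) (z : ℂ) : ℝ := fderiv ℝ p z Complex.I

/-- `X₁ = ∂/∂x₁ + iτ ∂p/∂x₂`. -/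
def X₁ (p : ℂ → ℝ) (τ : ℝ) (f : ℂ → ℂ) (z : ℂ) : ℂ :=
  pd₁ f z + Complex.I * τ * (pdR₂ p z) * f z

/-- `X₂ = ∂/∂x₂ - iτ ∂p/∂x₁`. -/
def X₂ (p : ℂ → ℝ) (τ : ℝ) (f : ℂ → ℂ) (z : ℂ) : ℂ :=
  pd₂ f z - Complex.I * τ * (pdR₁ p z) * f z

/-- Wirtinger derivative `∂/∂z = ½(∂/∂x₁ − i ∂/∂x₂)`. -/
def Wz (f : ℂ → ℂ) (z : ℂ) : ℂ := (1 / 2 : ℂ) * (pd₁ f z - Complex.I * pd₂ f z)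

/-- Wirtinger derivative `∂/∂z̄ = ½(∂/∂x₁ + i ∂/∂x₂)`. -/
def Wzb (f : ℂ → ℂ) (z : ℂ) : ℂ := (1 / 2 : ℂ) * (pd₁ f z + Complex.I * pd₂ f z)

/-- `Z̄_{τp} = ∂/∂z̄ + τ (∂p/∂z̄)`. -/
def Zb (p : ℂ → ℝ) (τ : ℝ) (f : ℂ → ℂ) (z : ℂ) : ℂ :=
  Wzb f z + τ * Wzb (fun w => (p w : ℂ)) z * f z

/-- `Z_{τp} = ∂/∂z − τ (∂p/∂z)`. -/
def Zop (p : ℂ → ℝ) (τ : ℝ) (f : ℂ → ℂ) (z : ℂ) : ℂ :=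
  Wz f z - τ * Wz (fun w => (p w : ℂ)) z * f z

/-- `□_{τp} = −Z̄_{τp} ∘ Z_{τp}`. -/
def Box (p : ℂ → ℝ) (τ : ℝ) (f : ℂ → ℂ) (z : ℂ) : ℂ := -(Zb p τ (Zop p τ f) z)

/-- `□̃_{τp} = −Z_{τp} ∘ Z̄_{τp}`. -/
def BoxT (p : ℂ → ℝ) (τ : ℝ) (f : ℂ → ℂ) (z : ℂ) : ℂ := -(Zop p τ (Zb p τ f) z)

/-- The Laplacian of a real-valued function on `ℂ ≅ ℝ²`. -/
def lapR (p : ℂ → ℝ) (z : ℂ) : ℝ :=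
  fderiv ℝ (fun w => pdR₁ p w) z 1 + fderiv ℝ (fun w => pdR₂ p w) z Complex.I

/-- `p : ℂ → ℝ` is a polynomial in the underlying real coordinates. -/
def IsRealPoly (p : ℂ → ℝ) : Prop :=
  ∃ P : MvPolynomial (Fin 2) ℝ, ∀ z : ℂ, p z = MvPolynomial.eval ![z.re, z.im] P

/-- `A_{jk}(z) = (1/(j!k!)) ∂^{j+k} p / ∂z^j ∂z̄^k (z)`. -/
def Ajk (p : ℂ → ℝ) (j k : ℕ) (z : ℂ) : ℂ :=
  (1 / (Nat.factorial j * Nat.factorial k) : ℂ) *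
    (Wz^[j] (Wzb^[k] (fun w => (p w : ℂ)))) z

/-- `μ_p(z,δ) = inf { |δ/A_{jk}(z)|^{1/(j+k)} : j,k ≥ 1, A_{jk}(z) ≠ 0 }`. -/
def mu (p : ℂ → ℝ) (z : ℂ) (δ : ℝ) : ℝ :=
  sInf { r : ℝ | ∃ j k : ℕ, 1 ≤ j ∧ 1 ≤ k ∧ Ajk p j k z ≠ 0 ∧
    r = ‖(δ : ℂ) / Ajk p j k z‖ ^ (((j + k : ℕ) : ℝ))⁻¹ }

/-- `Λ(z,δ) = Σ_{j,k ≥ 1} |A_{jk}(z)| δ^{j+k}`. -/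
def Lam (p : ℂ → ℝ) (z : ℂ) (δ : ℝ) : ℝ :=
  ∑' j : ℕ, ∑' k : ℕ, ‖Ajk p (j + 1) (k + 1) z‖ * δ ^ (j + k + 2)


lemma cs_aux (a b : ℝ) (hab : a < b) (u : ℝ → ℝ) (hu : ContinuousOn u (Set.Icc a b)) :
    (∫ t in a..b, u t) ^ 2 ≤ (b - a) * ∫ t in a..b, u t ^ 2 := by
  have hu' : ContinuousOn u (Set.uIcc a b) := by rwa [Set.uIcc_of_le hab.le]
  set J := ∫ t in a..b, u t with hJ
  have hpos : 0 < b - a := by linarith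
  set m := J / (b - a) with hm
  have h0 : 0 ≤ ∫ t in a..b, (u t - m) ^ 2 :=
    intervalIntegral.integral_nonneg hab.le (fun t _ => sq_nonneg _)
  have i1 : IntervalIntegrable (fun t => u t ^ 2) volume a b :=
    (hu'.pow 2).intervalIntegrable
  have i2 : IntervalIntegrable (fun t => 2 * m * u t) volume a b :=
    (continuousOn_const.mul hu').intervalIntegrable
  have h1 : ∫ t in a..b, (u t - m) ^ 2
      = (∫ t in a..b, u t ^ 2) - 2 * m * J + (b - a) * m ^ 2 := by
    have : ∀ t, (u t - m) ^ 2 = u t ^ 2 - 2 * m * u t + m ^ 2 := fun t => by ring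
    simp_rw [this]
    rw [intervalIntegral.integral_add (i1.sub i2) intervalIntegrable_const,
      intervalIntegral.integral_sub i1 i2, intervalIntegral.integral_const_mul]
    simp [hJ]
  have hmJ : J = m * (b - a) := by rw [hm]; field_simp
  rw [h1, hmJ] at h0
  rw [hmJ]
  nlinarith

lemma one_d (a b : ℝ) (hab : a < b) (g g' : ℝ → ℂ) (q : ℝ → ℝ) (hq : Continuous q)
    (hg : ∀ t ∈ Set.Icc a b, HasDerivAt g (g' t) t) (hg' : ContinuousOn g' (Set.Icc a b))
    (x : ℝ) (hx : x ∈ Set.Icc a b) :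
    ‖g x‖ ^ 2 ≤ 2 / (b - a) * (∫ t in a..b, ‖g t‖ ^ 2)
      + 2 * (b - a) * ∫ t in a..b, ‖g' t + I * q t * g t‖ ^ 2 := by
  have hpos : 0 < b - a := by linarith
  have hgc : ContinuousOn g (Set.Icc a b) := fun t ht => (hg t ht).continuousAt.continuousWithinAt
  set θ : ℝ → ℝ := fun t => ∫ s in a..t, q s with hθ
  have hθd : ∀ t, HasDerivAt θ (q t) t := fun t =>
    intervalIntegral.integral_hasDerivAt_right (hq.intervalIntegrable _ _)
      (hq.stronglyMeasurableAtFilter _ _) hq.continuousAt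
  have hθc : Continuous θ := continuous_iff_continuousAt.2 fun t => (hθd t).continuousAt
  set D : ℝ → ℂ := fun t => g' t + I * q t * g t with hD
  have hDc : ContinuousOn D (Set.Icc a b) := by
    have : Continuous fun t : ℝ => I * (q t : ℂ) := by fun_prop
    exact hg'.add (this.continuousOn.mul hgc)
  set E : ℝ → ℂ := fun t => Complex.exp ((θ t : ℂ) * I) with hE
  have hEn : ∀ t, ‖E t‖ = 1 := fun t => Complex.norm_exp_ofReal_mul_I _
  have hEc : Continuous E := by simp only [hE]; fun_prop
  have hder : ∀ t ∈ Set.Icc a b, HasDerivAt (fun t => E t * g t) (E t * D t) t := by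
    intro t ht
    have h1 : HasDerivAt E (E t * ((q t : ℂ) * I)) t :=
      ((hθd t).ofReal_comp.mul_const I).cexp
    have h2 := h1.mul (hg t ht)
    refine h2.congr_deriv ?_
    change _ = E t * (g' t + I * q t * g t)
    ring
  set N : ℝ → ℝ := fun t => ‖D t‖ with hN
  have hNc : ContinuousOn N (Set.Icc a b) := hDc.norm
  set J := ∫ t in a..b, N t with hJ
  have key : ∀ y ∈ Set.Icc a b, ‖g x‖ ≤ ‖g y‖ + J := by
    intro y hy
    have hsub : Set.uIcc y x ⊆ Set.Icc a b := Set.uIcc_subset_Icc hy hx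
    have hint : ∫ t in y..x, E t * D t = E x * g x - E y * g y :=
      intervalIntegral.integral_eq_sub_of_hasDerivAt (fun t ht => hder t (hsub ht))
        ((hEc.continuousOn.mul hDc).mono hsub).intervalIntegrable
    have h1 : ‖E x * g x - E y * g y‖ ≤ J := by
      rw [← hint]
      refine (intervalIntegral.norm_integral_le_integral_norm_uIoc).trans ?_
      rw [hJ, intervalIntegral.integral_of_le hab.le]
      have : ∀ t, ‖E t * D t‖ = N t := fun t => by rw [norm_mul, hEn, one_mul]
      simp_rw [this]
      refine setIntegral_mono_set ?_ (Filter.Eventually.of_forall fun t => norm_nonneg _) ?_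
      · exact (hNc.integrableOn_Icc).mono_set Set.Ioc_subset_Icc_self
      · refine Filter.Eventually.of_forall ?_
        intro t ht
        exact ⟨lt_of_le_of_lt (le_min hy.1 hx.1) ht.1, ht.2.trans (max_le hy.2 hx.2)⟩
    have h2 : ‖E x * g x‖ = ‖g x‖ := by rw [norm_mul, hEn, one_mul]
    have h3 : ‖E y * g y‖ = ‖g y‖ := by rw [norm_mul, hEn, one_mul]
    have h4 := norm_sub_norm_le (E x * g x) (E y * g y)
    linarith
  have hJ2 := cs_aux a b hab N hNc
  rw [← hJ] at hJ2
  have key2 : ∀ y ∈ Set.Icc a b, ‖g x‖ ^ 2 ≤ 2 * ‖g y‖ ^ 2 + 2 * J ^ 2 := by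
    intro y hy
    have := key y hy
    have h0 := norm_nonneg (g x)
    nlinarith [sq_nonneg (‖g y‖ - J)]
  have i1 : IntervalIntegrable (fun t => ‖g t‖ ^ 2) volume a b := by
    apply ContinuousOn.intervalIntegrable
    rw [Set.uIcc_of_le hab.le]; exact hgc.norm.pow 2
  have h5 : ∫ t in a..b, ‖g x‖ ^ 2 ≤ ∫ t in a..b, (2 * ‖g t‖ ^ 2 + 2 * J ^ 2) :=
    intervalIntegral.integral_mono_on hab.le intervalIntegrable_const
      ((i1.const_mul 2).add intervalIntegrable_const) key2
  rw [intervalIntegral.integral_add (i1.const_mul 2) intervalIntegrable_const,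
    intervalIntegral.integral_const_mul, intervalIntegral.integral_const,
    intervalIntegral.integral_const, smul_eq_mul, smul_eq_mul] at h5
  have h6 : ‖g x‖ ^ 2 ≤ 2 / (b - a) * (∫ t in a..b, ‖g t‖ ^ 2) + 2 * J ^ 2 := by
    have : 2 / (b - a) * (∫ t in a..b, ‖g t‖ ^ 2) + 2 * J ^ 2
      = (2 * (∫ t in a..b, ‖g t‖ ^ 2) + (b - a) * (2 * J ^ 2)) / (b - a) := by field_simp
    rw [this, le_div_iff₀ hpos]; linarith
  refine h6.trans ?_
  have : 2 * J ^ 2 ≤ 2 * (b - a) * ∫ t in a..b, N t ^ 2 := by linarith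
  simpa [hN, hD] using this

/-- Fubini on a rectangle. -/
lemma fub (a₁ b₁ a₂ b₂ : ℝ) (h1 : a₁ < b₁) (h2 : a₂ < b₂) (F : ℂ → ℝ)
    (hF : ContinuousOn F {z : ℂ | z.re ∈ Set.Icc a₁ b₁ ∧ z.im ∈ Set.Icc a₂ b₂}) :
    IntervalIntegrable (fun s => ∫ t in a₂..b₂, F ⟨s, t⟩) volume a₁ b₁ ∧
    ∫ y in {z : ℂ | z.re ∈ Set.Ioo a₁ b₁ ∧ z.im ∈ Set.Ioo a₂ b₂}, F y
      = ∫ s in a₁..b₁, ∫ t in a₂..b₂, F ⟨s, t⟩ := by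
  set G : ℝ × ℝ → ℝ := fun w => F ⟨w.1, w.2⟩ with hG
  have hmk : Continuous fun w : ℝ × ℝ => (⟨w.1, w.2⟩ : ℂ) :=
    Complex.equivRealProdCLM.symm.continuous
  have hGc : ContinuousOn G (Set.Icc a₁ b₁ ×ˢ Set.Icc a₂ b₂) :=
    hF.comp hmk.continuousOn (fun w hw => ⟨hw.1, hw.2⟩)
  have hGi : IntegrableOn G (Set.Icc a₁ b₁ ×ˢ Set.Icc a₂ b₂) :=
    hGc.integrableOn_compact (isCompact_Icc.prod isCompact_Icc)
  have hGi' : IntegrableOn G (Set.Ioo a₁ b₁ ×ˢ Set.Ioo a₂ b₂) (volume.prod volume) :=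
    hGi.mono_set (Set.prod_mono Set.Ioo_subset_Icc_self Set.Ioo_subset_Icc_self)
  have e2 : ∀ s, ∫ t in a₂..b₂, F ⟨s, t⟩ = ∫ t in Set.Ioo a₂ b₂, G (s, t) := fun s => by
    rw [intervalIntegral.integral_of_le h2.le, integral_Ioc_eq_integral_Ioo]
  constructor
  · rw [intervalIntegrable_iff_integrableOn_Ioo_of_le h1.le]
    simp_rw [e2]
    rw [IntegrableOn, ← Measure.prod_restrict] at hGi'
    exact hGi'.integral_prod_left
  · rw [intervalIntegral.integral_of_le h1.le, integral_Ioc_eq_integral_Ioo]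
    simp_rw [e2]
    rw [← setIntegral_prod _ hGi']
    have := Complex.volume_preserving_equiv_real_prod.setIntegral_preimage_emb
      Complex.measurableEquivRealProd.measurableEmbedding G (Set.Ioo a₁ b₁ ×ˢ Set.Ioo a₂ b₂)
    exact this

lemma horiz {f : ℂ → ℂ} {s t : ℝ} (h : DifferentiableAt ℝ f ⟨s, t⟩) :
    HasDerivAt (fun r : ℝ => f ⟨r, t⟩) (pd₁ f ⟨s, t⟩) s := by
  have h1 : HasDerivAt (fun r : ℝ => (⟨r, t⟩ : ℂ)) 1 s := by
    have : (fun r : ℝ => (⟨r, t⟩ : ℂ)) = fun r : ℝ => (r : ℂ) + t * I := by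
      funext r; exact Complex.mk_eq_add_mul_I r t
    rw [this]
    exact (hasDerivAt_id s).ofReal_comp.add_const _
  exact h.hasFDerivAt.comp_hasDerivAt s h1

lemma vert {f : ℂ → ℂ} {s t : ℝ} (h : DifferentiableAt ℝ f ⟨s, t⟩) :
    HasDerivAt (fun r : ℝ => f ⟨s, r⟩) (pd₂ f ⟨s, t⟩) t := by
  have h1 : HasDerivAt (fun r : ℝ => (⟨s, r⟩ : ℂ)) I t := by
    have : (fun r : ℝ => (⟨s, r⟩ : ℂ)) = fun r : ℝ => (s : ℂ) + r * I := by
      funext r; exact Complex.mk_eq_add_mul_I s r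
    rw [this]
    simpa using ((hasDerivAt_id t).ofReal_comp.mul_const I).const_add (s : ℂ)
  exact h.hasFDerivAt.comp_hasDerivAt t h1

lemma poly_smooth {p : ℂ → ℝ} (hp : IsRealPoly p) : ContDiff ℝ 3 p := by
  obtain ⟨P, hP⟩ := hp
  have : p = fun z => MvPolynomial.eval ![z.re, z.im] P := funext hP
  rw [this]
  have hre : ContDiff ℝ 3 Complex.re := Complex.reCLM.contDiff
  have him : ContDiff ℝ 3 Complex.im := Complex.imCLM.contDiff
  clear this hP
  induction P using MvPolynomial.induction_on with
  | C a => simpa using contDiff_const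
  | add P Q h1 h2 => simpa using h1.add h2
  | mul_X P i h =>
    fin_cases i
    · simpa using h.mul hre
    · simpa using h.mul him

lemma fd_smooth {V : Type*} [NormedAddCommGroup V] [NormedSpace ℝ V] {f : ℂ → V} {U : Set ℂ}
    (hU : IsOpen U) (n : ℕ)
    (hf : ContDiffOn ℝ (n + 1 : ℕ) f U) (v : ℂ) :
    ContDiffOn ℝ n (fun z => fderiv ℝ f z v) U :=
  (hf.fderiv_of_isOpen hU (by norm_cast)).clm_apply contDiffOn_const

/-- Theorem `thm:Poincare`: weighted Sobolev inequality on a square. -/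
theorem statement0 (p : ℂ → ℝ) (hpoly : IsRealPoly p) (τ : ℝ)
    (a₁ b₁ a₂ b₂ δ : ℝ) (hδ : 0 < δ) (hside₁ : b₁ - a₁ = δ) (hside₂ : b₂ - a₂ = δ)
    (Δ : Set ℂ) (hΔ : Δ = {z : ℂ | z.re ∈ Set.Ioo a₁ b₁ ∧ z.im ∈ Set.Ioo a₂ b₂})
    (f : ℂ → ℂ) (U : Set ℂ) (hU : IsOpen U) (hUΔ : closure Δ ⊆ U)
    (hf : ContDiffOn ℝ 2 f U)
    (x : ℂ) (hx : x ∈ Δ) :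
    ‖f x‖ ^ 2 ≤ 4 * ((1 / δ ^ 2) * (∫ y in Δ, ‖f y‖ ^ 2)
      + (∫ y in Δ, ‖X₁ p τ f y‖ ^ 2)
      + (∫ y in Δ, ‖X₂ p τ f y‖ ^ 2)
      + δ ^ 2 * (∫ y in Δ, ‖X₂ p τ (X₁ p τ f) y‖ ^ 2)) := by
  have h1 : a₁ < b₁ := by linarith
  have h2 : a₂ < b₂ := by linarith
  have hp := poly_smooth hpoly
  have hp1 : ContDiff ℝ 2 (pdR₁ p) := contDiffOn_univ.1
    (fd_smooth isOpen_univ 2 (by exact_mod_cast hp.contDiffOn) 1)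
  have hp2 : ContDiff ℝ 2 (pdR₂ p) := contDiffOn_univ.1
    (fd_smooth isOpen_univ 2 (by exact_mod_cast hp.contDiffOn) I)
  have hf1 : ContDiffOn ℝ 1 f U := hf.of_le (by norm_num)
  have c1 : ContDiffOn ℝ 1 (fun z => I * (τ : ℂ) * (pdR₂ p z : ℂ)) U :=
    (contDiff_const.mul (Complex.ofRealCLM.contDiff.comp (hp2.of_le (by norm_num)))).contDiffOn
  have c2 : Continuous (fun z => I * (τ : ℂ) * (pdR₁ p z : ℂ)) :=
    continuous_const.mul (Complex.continuous_ofReal.comp hp1.continuous)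
  have hX1 : ContDiffOn ℝ 1 (X₁ p τ f) U :=
    (fd_smooth hU 1 (by exact_mod_cast hf) 1).add (c1.mul hf1)
  have hX2gen : ∀ g : ℂ → ℂ, ContDiffOn ℝ 1 g U → ContinuousOn (X₂ p τ g) U := fun g hg =>
    (fd_smooth hU 0 (by exact_mod_cast hg) I).continuousOn.sub
      (c2.continuousOn.mul hg.continuousOn)
  set K : Set ℂ := {z : ℂ | z.re ∈ Set.Icc a₁ b₁ ∧ z.im ∈ Set.Icc a₂ b₂} with hK
  have hKU : K ⊆ U := by
    refine subset_trans ?_ hUΔ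
    have e1 : Δ = Set.Ioo a₁ b₁ ×ℂ Set.Ioo a₂ b₂ := by rw [hΔ]; rfl
    rw [e1, Complex.closure_reProdIm, closure_Ioo h1.ne, closure_Ioo h2.ne]
    exact fun z hz => hz
  have hmk1 : ∀ t : ℝ, Continuous fun s : ℝ => (⟨s, t⟩ : ℂ) := fun t =>
    Complex.equivRealProdCLM.symm.continuous.comp (by fun_prop : Continuous fun s : ℝ => (s, t))
  have hmk2 : ∀ s : ℝ, Continuous fun t : ℝ => (⟨s, t⟩ : ℂ) := fun s =>
    Complex.equivRealProdCLM.symm.continuous.comp (by fun_prop : Continuous fun t : ℝ => (s, t))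
  rw [hΔ] at hx
  obtain ⟨hx1, hx2⟩ := hx
  have hx1' := Set.Ioo_subset_Icc_self hx1
  have hx2' := Set.Ioo_subset_Icc_self hx2
  have hvert : ∀ g : ℂ → ℂ, ContDiffOn ℝ 1 g U → ∀ s ∈ Set.Icc a₁ b₁,
      ‖g ⟨s, x.im⟩‖ ^ 2 ≤ 2 / δ * (∫ t in a₂..b₂, ‖g ⟨s, t⟩‖ ^ 2)
        + 2 * δ * ∫ t in a₂..b₂, ‖X₂ p τ g ⟨s, t⟩‖ ^ 2 := by
    intro g hg s hs
    have := one_d a₂ b₂ h2 (fun t => g ⟨s, t⟩) (fun t => pd₂ g ⟨s, t⟩)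
      (fun t => -(τ * pdR₁ p ⟨s, t⟩))
      ((continuous_const.mul (hp1.continuous.comp (hmk2 s))).neg)
      (fun t ht => vert ((hg.differentiableOn one_ne_zero).differentiableAt
        (hU.mem_nhds (hKU ⟨hs, ht⟩))))
      ((fd_smooth hU 0 (by exact_mod_cast hg) I).continuousOn.comp (hmk2 s).continuousOn
        (fun t ht => hKU ⟨hs, ht⟩)) x.im hx2'
    rw [hside₂] at this
    convert this using 6
    simp only [X₂]; push_cast; ring_nf
  have hhor : ‖f x‖ ^ 2 ≤ 2 / δ * (∫ s in a₁..b₁, ‖f ⟨s, x.im⟩‖ ^ 2)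
        + 2 * δ * ∫ s in a₁..b₁, ‖X₁ p τ f ⟨s, x.im⟩‖ ^ 2 := by
    have := one_d a₁ b₁ h1 (fun s => f ⟨s, x.im⟩) (fun s => pd₁ f ⟨s, x.im⟩)
      (fun s => τ * pdR₂ p ⟨s, x.im⟩)
      (continuous_const.mul (hp2.continuous.comp (hmk1 x.im)))
      (fun s hs => horiz ((hf1.differentiableOn one_ne_zero).differentiableAt
        (hU.mem_nhds (hKU ⟨hs, hx2'⟩))))
      ((fd_smooth hU 0 (by exact_mod_cast hf1) 1).continuousOn.comp (hmk1 x.im).continuousOn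
        (fun s hs => hKU ⟨hs, hx2'⟩)) x.re hx1'
    rw [hside₁] at this
    convert this using 6
    simp only [X₁]; push_cast; ring_nf
  have hint : ∀ g : ℂ → ℂ, ContDiffOn ℝ 1 g U →
      ∫ s in a₁..b₁, ‖g ⟨s, x.im⟩‖ ^ 2 ≤ 2 / δ * (∫ y in Δ, ‖g y‖ ^ 2)
        + 2 * δ * ∫ y in Δ, ‖X₂ p τ g y‖ ^ 2 := by
    intro g hg
    obtain ⟨iA, eA⟩ := fub a₁ b₁ a₂ b₂ h1 h2 (fun y => ‖g y‖ ^ 2)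
      ((hg.continuousOn.mono hKU).norm.pow 2)
    obtain ⟨iB, eB⟩ := fub a₁ b₁ a₂ b₂ h1 h2 (fun y => ‖X₂ p τ g y‖ ^ 2)
      (((hX2gen g hg).mono hKU).norm.pow 2)
    rw [hΔ, eA, eB, ← intervalIntegral.integral_const_mul,
      ← intervalIntegral.integral_const_mul,
      ← intervalIntegral.integral_add (iA.const_mul _) (iB.const_mul _)]
    refine intervalIntegral.integral_mono_on h1.le ?_
      ((iA.const_mul _).add (iB.const_mul _)) (fun s hs => hvert g hg s hs)
    apply ContinuousOn.intervalIntegrable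
    rw [Set.uIcc_of_le h1.le]
    exact (hg.continuousOn.comp (hmk1 x.im).continuousOn
        (fun s hs => hKU ⟨hs, hx2'⟩)).norm.pow 2
  have k1 := hint f hf1
  have k2 := hint _ hX1
  have m1 := mul_le_mul_of_nonneg_left k1 (by positivity : 0 ≤ 2 / δ)
  have m2 := mul_le_mul_of_nonneg_left k2 (by positivity : 0 ≤ 2 * δ)
  refine (hhor.trans (add_le_add m1 m2)).trans (le_of_eq ?_)
  field_simp
  ring

end
end

section
/- Assume in addition that p is subharmonic and nonharmonic (Δp ≥ 0 everywhere and Δp not identically zero) and that τ > 0. Then there exists a constant C > 0, depending only on p, such that for every δ > 0, every z ∈ ℂ, and every complex-valued C² function f with compact support contained in the Euclidean disk D(z,δ), one has |f(z)| ≤ (C/δ) ( ‖f‖_{L²(D(z,δ))} + δ² ‖□_{τp} f‖_{L²(D(z,δ))} ). -/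
open MeasureTheory Complex

noncomputable section

def ee (θ : ℝ) : ℂ := (Real.cos θ : ℂ) + (Real.sin θ : ℂ) * I
def nuR (R : ℝ) : Measure ℝ := volume.restrict (Set.Ioc 0 R)
def nuT : Measure ℝ := volume.restrict (Set.Ioc (-Real.pi) Real.pi)
instance (R : ℝ) : IsFiniteMeasure (nuR R) := by unfold nuR; infer_instance
instance : IsFiniteMeasure nuT := by unfold nuT; infer_instance

lemma continuous_ee : Continuous ee := by unfold ee; fun_prop

lemma hasDerivAt_ee (θ : ℝ) : HasDerivAt ee (I * ee θ) θ := by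
  have h1 := (Real.hasDerivAt_cos θ).ofReal_comp
  have h2 := ((Real.hasDerivAt_sin θ).ofReal_comp).mul_const I
  have := h1.add h2
  refine this.congr_deriv ?_
  unfold ee
  apply Complex.ext <;> simp

lemma norm_ee (θ : ℝ) : ‖ee θ‖ = 1 := by
  have : ee θ = Complex.exp (θ * I) := by
    rw [Complex.exp_mul_I]; simp [ee]
  rw [this, Complex.norm_exp_ofReal_mul_I]

lemma integrable_cont (R : ℝ) (K : ℝ × ℝ → ℝ) (hK : Continuous K) (g : ℝ → ℝ)
    (hg : Integrable g (nuR R)) : Integrable (fun x => g x.1 * K x) ((nuR R).prod nuT) := by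
  obtain ⟨c, hc⟩ := (isCompact_Icc (a := ((0:ℝ), -Real.pi)) (b := (R, Real.pi))).exists_bound_of_continuousOn
    hK.continuousOn
  refine (hg.comp_fst nuT).mul_bdd (c := c) hK.aestronglyMeasurable ?_
  unfold nuR nuT
  rw [Measure.prod_restrict]
  refine ae_restrict_of_forall_mem (measurableSet_Ioc.prod measurableSet_Ioc) ?_
  rintro ⟨r, t⟩ ⟨h1, h2⟩
  exact hc _ ⟨⟨h1.1.le, h2.1.le⟩, ⟨h1.2, h2.2⟩⟩

lemma integrable_logR (R : ℝ) (hR : 0 < R) :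
    Integrable (fun r => Real.log R - Real.log r) (nuR R) := by
  have : IntervalIntegrable (fun r => Real.log R - Real.log r) volume 0 R :=
    (intervalIntegrable_const).sub intervalIntegral.intervalIntegrable_log'
  exact (intervalIntegrable_iff_integrableOn_Ioc_of_le hR.le).1 this

/-- Laplacian via second derivative -/
def lap2 (u : ℂ → ℝ) (y : ℂ) : ℝ :=
  fderiv ℝ (fderiv ℝ u) y 1 1 + fderiv ℝ (fderiv ℝ u) y I I

lemma lap2_rot (u : ℂ → ℝ) (y : ℂ) (θ : ℝ) :
    lap2 u y = fderiv ℝ (fderiv ℝ u) y (ee θ) (ee θ) +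
      fderiv ℝ (fderiv ℝ u) y (I * ee θ) (I * ee θ) := by
  have h1 : ee θ = Real.cos θ • (1:ℂ) + Real.sin θ • I := by simp [ee]
  have h2 : I * ee θ = Real.cos θ • I - Real.sin θ • (1:ℂ) := by
    unfold ee; apply Complex.ext <;> simp
  rw [h2, h1]
  simp only [map_add, map_sub, map_smul, add_apply,
    sub_apply, smul_apply, smul_eq_mul, lap2]
  linear_combination (fderiv ℝ (fderiv ℝ u) y 1 1 + fderiv ℝ (fderiv ℝ u) y I I) *
    (-(Real.sin_sq_add_cos_sq θ))

lemma hasDerivAt_along (L : ℂ → ℂ →L[ℝ] ℝ) (L' : ℂ →L[ℝ] ℂ →L[ℝ] ℝ) (γ V : ℝ → ℂ) (γ' V' : ℂ) (t : ℝ)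
    (hL : HasFDerivAt L L' (γ t)) (hγ : HasDerivAt γ γ' t) (hV : HasDerivAt V V' t) :
    HasDerivAt (fun s => L (γ s) (V s)) (L' γ' (V t) + L (γ t) V') t := by
  have h1 : HasDerivAt (fun s => L (γ s)) (L' γ') t := hL.comp_hasDerivAt t hγ
  exact h1.clm_apply hV

lemma polar_green (u : ℂ → ℝ) (hu : ContDiff ℝ 2 u) (w : ℂ) (R : ℝ) (hR : 0 < R)
    (h0 : ∀ θ, u (w + R * ee θ) = 0) :
    Integrable (fun x : ℝ × ℝ => (Real.log R - Real.log x.1) * (x.1 * lap2 u (w + x.1 * ee x.2)))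
      ((nuR R).prod nuT) ∧
    ∫ x : ℝ × ℝ, (Real.log R - Real.log x.1) * (x.1 * lap2 u (w + x.1 * ee x.2))
      ∂((nuR R).prod nuT) = - (2 * Real.pi * u w) := by
  have hu1 : ContDiff ℝ 1 (fderiv ℝ u) := hu.fderiv_right (by norm_num)
  have hd0 : ∀ y, HasFDerivAt u (fderiv ℝ u y) y := fun y =>
    (hu.differentiable (by norm_num) y).hasFDerivAt
  have hd1 : ∀ y, HasFDerivAt (fderiv ℝ u) (fderiv ℝ (fderiv ℝ u) y) y := fun y =>
    (hu1.differentiable (by norm_num) y).hasFDerivAt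
  have hc1 : Continuous (fderiv ℝ u) := hu1.continuous
  have hc2 : Continuous (fderiv ℝ (fderiv ℝ u)) := hu1.continuous_fderiv (by norm_num)
  have hce := continuous_ee
  have hcu := hu.continuous
  set A : ℝ × ℝ → ℝ := fun x => fderiv ℝ u (w + x.1 * ee x.2) (ee x.2) +
    x.1 * fderiv ℝ (fderiv ℝ u) (w + x.1 * ee x.2) (ee x.2) (ee x.2) with hA
  set B : ℝ × ℝ → ℝ := fun x =>
    x.1 * fderiv ℝ (fderiv ℝ u) (w + x.1 * ee x.2) (I * ee x.2) (I * ee x.2) -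
    fderiv ℝ u (w + x.1 * ee x.2) (ee x.2) with hB
  have hpos : Continuous (fun x : ℝ × ℝ => w + x.1 * ee x.2) := by fun_prop
  have hee : Continuous (fun x : ℝ × ℝ => ee x.2) := by fun_prop
  have hAc : Continuous A := by
    refine ((hc1.comp hpos).clm_apply hee).add (continuous_fst.mul ?_)
    exact ((hc2.comp hpos).clm_apply hee).clm_apply hee
  have hBc : Continuous B := by
    refine Continuous.sub (continuous_fst.mul ?_) ((hc1.comp hpos).clm_apply hee)
    exact ((hc2.comp hpos).clm_apply (continuous_const.mul hee)).clm_apply (continuous_const.mul hee)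
  have hlog := integrable_logR R hR
  have hAi := integrable_cont R A hAc _ hlog
  have hBi := integrable_cont R B hBc _ hlog
  have hsum : (fun x : ℝ × ℝ => (Real.log R - Real.log x.1) * (x.1 * lap2 u (w + x.1 * ee x.2))) =
      fun x => (Real.log R - Real.log x.1) * A x + (Real.log R - Real.log x.1) * B x := by
    funext x
    rw [lap2_rot u _ x.2, hA, hB]
    ring
  rw [hsum]
  refine ⟨hAi.add hBi, ?_⟩
  rw [integral_add hAi hBi, integral_prod_symm _ hAi, integral_prod _ hBi]
  have hAint : ∀ θ, ∫ r, (Real.log R - Real.log r) * A (r, θ) ∂(nuR R) = - u w := by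
    intro θ
    unfold nuR
    rw [← intervalIntegral.integral_of_le hR.le]
    have hline : ∀ r : ℝ, HasDerivAt (fun r : ℝ => w + (r:ℂ) * ee θ) (ee θ) r := by
      intro r
      simpa using ((hasDerivAt_id r).ofReal_comp.mul_const (ee θ)).const_add w
    have key := intervalIntegral.integral_eq_sub_of_hasDerivAt_of_le
      (f := fun r : ℝ => (r * Real.log R - r * Real.log r) * fderiv ℝ u (w + r * ee θ) (ee θ)
        + u (w + r * ee θ)) (f' := fun r => (Real.log R - Real.log r) * A (r, θ)) hR.le ?_ ?_ ?_
    · rw [key]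
      simp [h0]
    · apply Continuous.continuousOn
      refine (((continuous_id.mul continuous_const).sub Real.continuous_mul_log).mul
        ((hc1.comp ?_).clm_apply continuous_const)).add (hcu.comp ?_) <;> fun_prop
    · intro r hr
      have hr0 : r ≠ 0 := hr.1.ne'
      have k1 := (hd0 (w + r * ee θ)).comp_hasDerivAt r (hline r)
      have k2 := hasDerivAt_along _ _ (fun r : ℝ => w + (r:ℂ) * ee θ) (fun _ => ee θ) _ _ r
        (hd1 (w + r * ee θ)) (hline r) (hasDerivAt_const r (ee θ))
      have k3 := ((hasDerivAt_id r).mul_const (Real.log R)).sub (Real.hasDerivAt_mul_log hr0)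
      have k4 := (k3.mul k2).add k1
      refine k4.congr_deriv ?_
      simp [hA]
      ring
    · refine (IntervalIntegrable.mul_continuousOn ?_ ?_)
      · exact (intervalIntegrable_const).sub intervalIntegral.intervalIntegrable_log'
      · exact (hAc.comp (by fun_prop : Continuous fun r : ℝ => (r, θ))).continuousOn
  have hBint : ∀ r, ∫ θ, (Real.log R - Real.log r) * B (r, θ) ∂nuT = 0 := by
    intro r
    rw [integral_const_mul]
    unfold nuT
    rw [← intervalIntegral.integral_of_le (by linarith [Real.pi_pos])]
    have hder : ∀ θ : ℝ, HasDerivAt (fun θ : ℝ => w + (r:ℂ) * ee θ) (r * (I * ee θ)) θ := by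
      intro θ
      exact ((hasDerivAt_ee θ).const_mul (r:ℂ)).const_add w
    have key := intervalIntegral.integral_eq_sub_of_hasDerivAt
      (a := -Real.pi) (b := Real.pi)
      (f := fun θ : ℝ => fderiv ℝ u (w + r * ee θ) (I * ee θ)) (f' := fun θ => B (r, θ)) ?_ ?_
    · rw [key]
      simp [ee]
    · intro θ _
      have k2 := hasDerivAt_along _ _ (fun θ : ℝ => w + (r:ℂ) * ee θ) (fun θ => I * ee θ) _ _ θ
        (hd1 (w + r * ee θ)) (hder θ) ((hasDerivAt_ee θ).const_mul I)
      refine k2.congr_deriv ?_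
      have e1 : (r:ℂ) * (I * ee θ) = r • (I * ee θ) := by simp
      have e2 : I * (I * ee θ) = - ee θ := by rw [← mul_assoc]; simp
      rw [e1, e2]
      simp only [hB, map_smul, smul_apply, map_neg, smul_eq_mul]
      ring
    · exact (hBc.comp (by fun_prop : Continuous fun θ : ℝ => (r, θ))).intervalIntegrable _ _
  simp only [hAint, hBint]
  unfold nuT
  simp [Real.pi_pos.le]
  left
  ring

lemma polar_int (h : ℂ → ℝ) (w : ℂ) (R : ℝ) (h0 : ∀ y, R < ‖y - w‖ → h y = 0) :
    ∫ x : ℝ × ℝ, x.1 * h (w + x.1 * ee x.2) ∂((nuR R).prod nuT) = ∫ y, h y := by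
  rw [← integral_add_left_eq_self h w, ← Complex.integral_comp_polarCoord_symm]
  rw [_root_.polarCoord_target]
  unfold nuR nuT
  rw [← restrict_Ioo_eq_restrict_Ioc (a := -Real.pi), Measure.prod_restrict]
  rw [setIntegral_eq_of_subset_of_forall_sdiff_eq_zero
    (s := Set.Ioc 0 R ×ˢ Set.Ioo (-Real.pi) Real.pi) (measurableSet_Ioi.prod measurableSet_Ioo)]
  · simp only [Complex.polarCoord_symm_apply, smul_eq_mul]
    rfl
  · exact Set.prod_mono Set.Ioc_subset_Ioi_self subset_rfl
  · rintro ⟨r, t⟩ ⟨⟨h1, h2⟩, h3⟩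
    have hr : R < r := by
      by_contra hcon
      exact h3 ⟨⟨h1, not_lt.1 hcon⟩, h2⟩
    rw [Complex.polarCoord_symm_apply, smul_eq_mul, h0, mul_zero]
    have := norm_ee t
    unfold ee at this
    rw [add_sub_cancel_left, norm_mul, this]
    simpa using lt_of_lt_of_le hr (le_abs_self r)

lemma fderiv_fderiv_apply {F : Type*} [NormedAddCommGroup F] [NormedSpace ℝ F] {f : ℂ → F}
    (hf : ContDiff ℝ 2 f) (y v v' : ℂ) :
    HasFDerivAt (fun w => fderiv ℝ f w v) ((fderiv ℝ (fderiv ℝ f) y).flip v) y := by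
  have hu1 : ContDiff ℝ 1 (fderiv ℝ f) := hf.fderiv_right (by norm_num)
  have h := (hu1.differentiable (by norm_num) y).hasFDerivAt
  have := h.clm_apply (hasFDerivAt_const v y)
  simpa using this

lemma fderiv_ofReal {p : ℂ → ℝ} (hp : Differentiable ℝ p) (y v : ℂ) :
    fderiv ℝ (fun w => (p w : ℂ)) y v = ((fderiv ℝ p y v : ℝ) : ℂ) := by
  have : HasFDerivAt (fun w => (p w : ℂ)) (Complex.ofRealCLM.comp (fderiv ℝ p y)) y :=
    Complex.ofRealCLM.hasFDerivAt.comp y (hp y).hasFDerivAt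
  rw [this.fderiv]; rfl

lemma hasFDerivAt_Zop {p : ℂ → ℝ} (hp : ContDiff ℝ 2 p) (τ : ℝ) {f : ℂ → ℂ} (hf : ContDiff ℝ 2 f)
    (y v : ℂ) :
    fderiv ℝ (Zop p τ f) y v =
      (1 / 2 : ℂ) * (fderiv ℝ (fderiv ℝ f) y v 1 - I * fderiv ℝ (fderiv ℝ f) y v I)
      - (τ * ((1 / 2 : ℂ) * (((fderiv ℝ (fderiv ℝ p) y v 1 : ℝ) : ℂ)
          - I * ((fderiv ℝ (fderiv ℝ p) y v I : ℝ) : ℂ)))) * f y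
      - (τ * ((1 / 2 : ℂ) * (((fderiv ℝ p y 1 : ℝ) : ℂ)
          - I * ((fderiv ℝ p y I : ℝ) : ℂ)))) * fderiv ℝ f y v := by
  have hpd := hp.differentiable (by norm_num)
  have e : Zop p τ f = fun w => (1 / 2 : ℂ) * (fderiv ℝ f w 1 - I * fderiv ℝ f w I)
      - (τ * ((1 / 2 : ℂ) * (((fderiv ℝ p w 1 : ℝ) : ℂ)
          - I * ((fderiv ℝ p w I : ℝ) : ℂ)))) * f w := by
    funext w
    simp only [Zop, Wz, pd₁, pd₂, fderiv_ofReal hpd]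
  have a1 := fderiv_fderiv_apply hf y 1 v
  have a2 := fderiv_fderiv_apply hf y I v
  have b1 := Complex.ofRealCLM.hasFDerivAt.comp y (fderiv_fderiv_apply hp y 1 v)
  have b2 := Complex.ofRealCLM.hasFDerivAt.comp y (fderiv_fderiv_apply hp y I v)
  have c := (hf.differentiable (by norm_num) y).hasFDerivAt
  have h := ((a1.sub (a2.const_mul I)).const_mul (1/2:ℂ)).sub
    ((((b1.sub (b2.const_mul I)).const_mul (1/2:ℂ)).const_mul (τ:ℂ)).mul c)
  rw [e]
  refine (congrArg (fun L => L v) h.fderiv).trans ?_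
  simp
  ring

lemma Box_eq {p : ℂ → ℝ} (hp : ContDiff ℝ 2 p) (τ : ℝ) {f : ℂ → ℂ} (hf : ContDiff ℝ 2 f) (y : ℂ) :
    Box p τ f y = -(1/4 : ℂ) * (fderiv ℝ (fderiv ℝ f) y 1 1 + fderiv ℝ (fderiv ℝ f) y I I
      - τ * (((fderiv ℝ (fderiv ℝ p) y 1 1 + fderiv ℝ (fderiv ℝ p) y I I : ℝ)) : ℂ) * f y
      + 2 * I * τ * ((fderiv ℝ p y I : ℝ) : ℂ) * fderiv ℝ f y 1
      - 2 * I * τ * ((fderiv ℝ p y 1 : ℝ) : ℂ) * fderiv ℝ f y I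
      - τ ^ 2 * (((fderiv ℝ p y 1) ^ 2 + (fderiv ℝ p y I) ^ 2 : ℝ) : ℂ) * f y) := by
  have hpd := hp.differentiable (by norm_num)
  have sf : fderiv ℝ (fderiv ℝ f) y 1 I = fderiv ℝ (fderiv ℝ f) y I 1 :=
    (hf.contDiffAt.isSymmSndFDerivAt (by simp)) 1 I
  have sp : fderiv ℝ (fderiv ℝ p) y 1 I = fderiv ℝ (fderiv ℝ p) y I 1 :=
    (hp.contDiffAt.isSymmSndFDerivAt (by simp)) 1 I
  simp only [Box, Zb, Wzb, pd₁, pd₂, hasFDerivAt_Zop hp τ hf, fderiv_ofReal hpd]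
  simp only [Zop, Wz, pd₁, pd₂, fderiv_ofReal hpd, sf, sp]
  push_cast
  ring_nf
  simp only [Complex.I_sq]
  ring

lemma lap2_normSq {f : ℂ → ℂ} (hf : ContDiff ℝ 2 f) (y : ℂ) :
    lap2 (fun y => ‖f y‖ ^ 2) y =
      2 * (inner ℝ (f y) (fderiv ℝ (fderiv ℝ f) y 1 1 + fderiv ℝ (fderiv ℝ f) y I I))
      + 2 * ‖fderiv ℝ f y 1‖ ^ 2 + 2 * ‖fderiv ℝ f y I‖ ^ 2 := by
  have hu : ContDiff ℝ 2 (fun y => ‖f y‖ ^ 2) := hf.norm_sq ℝ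
  have hfd := hf.differentiable (by norm_num)
  have key : ∀ v : ℂ, fderiv ℝ (fderiv ℝ (fun y => ‖f y‖ ^ 2)) y v v =
      2 * inner ℝ (f y) (fderiv ℝ (fderiv ℝ f) y v v) + 2 * ‖fderiv ℝ f y v‖ ^ 2 := by
    intro v
    have h1 := (fderiv_fderiv_apply hu y v v).fderiv
    have e : (fun w => fderiv ℝ (fun y => ‖f y‖ ^ 2) w v) =
        fun w => 2 * inner ℝ (f w) (fderiv ℝ f w v) := by
      funext w
      simp_rw [← real_inner_self_eq_norm_sq]
      rw [fderiv_inner_apply ℝ (hfd w) (hfd w), real_inner_comm (f w)]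
      ring
    rw [e] at h1
    have h2 := congrArg (fun L => L v) h1
    simp only [ContinuousLinearMap.flip_apply] at h2
    rw [← h2]
    have a := fderiv_fderiv_apply hf y v v
    rw [fderiv_const_mul ((hfd y).inner ℝ a.differentiableAt)]
    rw [smul_apply, fderiv_inner_apply ℝ (hfd y) a.differentiableAt, a.fderiv]
    simp only [ContinuousLinearMap.flip_apply, smul_eq_mul, real_inner_self_eq_norm_sq]
    ring
  rw [lap2, key, key, inner_add_right]
  ring

lemma lapR_eq {p : ℂ → ℝ} (hp : ContDiff ℝ 2 p) (y : ℂ) :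
    lapR p y = fderiv ℝ (fderiv ℝ p) y 1 1 + fderiv ℝ (fderiv ℝ p) y I I := by
  unfold lapR pdR₁ pdR₂
  rw [(fderiv_fderiv_apply hp y 1 1).fderiv, (fderiv_fderiv_apply hp y I 1).fderiv]
  rfl

lemma kato {p : ℂ → ℝ} (hp : ContDiff ℝ 2 p) (τ : ℝ) (hτ : 0 < τ) {f : ℂ → ℂ}
    (hf : ContDiff ℝ 2 f) (y : ℂ) (hl : 0 ≤ lapR p y) :
    -(8 * ‖f y‖ * ‖Box p τ f y‖) ≤ lap2 (fun y => ‖f y‖ ^ 2) y := by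
  have hb := Box_eq hp τ hf y
  have h1 := real_inner_le_norm (f y) (Box p τ f y)
  rw [lap2_normSq hf]
  rw [lapR_eq hp] at hl
  have id : 2 * (inner ℝ (f y) (fderiv ℝ (fderiv ℝ f) y 1 1 + fderiv ℝ (fderiv ℝ f) y I I))
      + 2 * ‖fderiv ℝ f y 1‖ ^ 2 + 2 * ‖fderiv ℝ f y I‖ ^ 2 =
      -8 * inner ℝ (f y) (Box p τ f y) +
      2 * τ * (fderiv ℝ (fderiv ℝ p) y 1 1 + fderiv ℝ (fderiv ℝ p) y I I) * ‖f y‖ ^ 2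
      + 2 * ‖fderiv ℝ f y 1 + I * τ * ((fderiv ℝ p y I : ℝ) : ℂ) * f y‖ ^ 2
      + 2 * ‖fderiv ℝ f y I - I * τ * ((fderiv ℝ p y 1 : ℝ) : ℂ) * f y‖ ^ 2 := by
    rw [hb]
    generalize fderiv ℝ (fderiv ℝ f) y 1 1 + fderiv ℝ (fderiv ℝ f) y I I = L
    generalize fderiv ℝ (fderiv ℝ p) y 1 1 + fderiv ℝ (fderiv ℝ p) y I I = P
    generalize fderiv ℝ f y 1 = a
    generalize fderiv ℝ f y I = b
    generalize fderiv ℝ p y 1 = c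
    generalize fderiv ℝ p y I = d
    generalize f y = g
    simp only [← Complex.normSq_eq_norm_sq, Complex.normSq_apply, Complex.inner]
    simp [pow_two]
    ring
  rw [id]
  have h2 : 0 ≤ 2 * τ * (fderiv ℝ (fderiv ℝ p) y 1 1 + fderiv ℝ (fderiv ℝ p) y I I) * ‖f y‖ ^ 2 := by
    positivity
  have h3 := sq_nonneg ‖fderiv ℝ f y 1 + I * τ * ((fderiv ℝ p y I : ℝ) : ℂ) * f y‖
  have h4 := sq_nonneg ‖fderiv ℝ f y I - I * τ * ((fderiv ℝ p y 1 : ℝ) : ℂ) * f y‖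
  nlinarith

lemma contDiff_poly {p : ℂ → ℝ} (hpoly : IsRealPoly p) : ContDiff ℝ 2 p := by
  obtain ⟨P, hP⟩ := hpoly
  have : p = fun z : ℂ => MvPolynomial.eval ![z.re, z.im] P := funext hP
  rw [this]
  clear this hP
  induction P using MvPolynomial.induction_on with
  | C a => simpa using contDiff_const
  | add p q hp hq => simpa using hp.add hq
  | mul_X p i hp =>
    simp only [map_mul, MvPolynomial.eval_X]
    refine hp.mul ?_
    fin_cases i
    · exact Complex.reCLM.contDiff
    · exact Complex.imCLM.contDiff

lemma continuous_Box {p : ℂ → ℝ} (hp : ContDiff ℝ 2 p) (τ : ℝ) {f : ℂ → ℂ} (hf : ContDiff ℝ 2 f) :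
    Continuous (Box p τ f) := by
  have h1 : ContDiff ℝ 1 (fderiv ℝ f) := hf.fderiv_right (by norm_num)
  have h2 : ContDiff ℝ 1 (fderiv ℝ p) := hp.fderiv_right (by norm_num)
  have c1 := h1.continuous
  have c2 := h2.continuous
  have c3 : Continuous (fderiv ℝ (fderiv ℝ f)) := h1.continuous_fderiv (by norm_num)
  have c4 : Continuous (fderiv ℝ (fderiv ℝ p)) := h2.continuous_fderiv (by norm_num)
  have c5 := hf.continuous
  rw [funext (Box_eq hp τ hf)]
  fun_prop

lemma Box_zero {p : ℂ → ℝ} (hp : ContDiff ℝ 2 p) (τ : ℝ) {f : ℂ → ℂ} (hf : ContDiff ℝ 2 f) (y : ℂ)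
    (hy : y ∉ tsupport f) : Box p τ f y = 0 := by
  have h0 : f =ᶠ[nhds y] 0 := notMem_tsupport_iff_eventuallyEq.1 hy
  have h1 : fderiv ℝ f =ᶠ[nhds y] 0 := by
    have := h0.fderiv (𝕜 := ℝ)
    simpa using this
  have h2 : fderiv ℝ (fderiv ℝ f) y = 0 := by
    rw [h1.fderiv_eq]; simp
  rw [Box_eq hp τ hf, h2, h1.self_of_nhds, h0.self_of_nhds]
  simp

lemma final_bound {M R N : ℝ} (hM : 0 ≤ M) (hR : 0 < R) (hN : 0 ≤ N)
    (h : ∀ ε : ℝ, 0 < ε →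
      2 * Real.pi * M ^ 2 ≤ 4 * M * (4 * R * ε * (R * (2 * Real.pi)) + N ^ 2 / ε)) :
    M ≤ 18 * R * N := by
  rcases hM.eq_or_lt with h0 | hM
  · rw [← h0]; positivity
  refine le_of_forall_pos_le_add fun η hη => ?_
  set N' := N + η / (18 * R) with hN'
  have hq : 0 < η / (18 * R) := by positivity
  have hN'0 : 0 < N' := by linarith
  have h1 := h (N' / R) (by positivity)
  have e1 : N ^ 2 / (N' / R) ≤ N' * R := by
    rw [div_le_iff₀ (by positivity)]
    have : N' * R * (N' / R) = N' ^ 2 := by field_simp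
    rw [this]
    exact pow_le_pow_left₀ hN (by linarith) 2
  have e2 : 4 * R * (N' / R) * (R * (2 * Real.pi)) = 8 * Real.pi * (N' * R) := by field_simp; ring
  rw [e2] at h1
  have e3 : 2 * Real.pi * M ^ 2 ≤ 4 * M * (8 * Real.pi * (N' * R) + N' * R) :=
    h1.trans (by gcongr)
  have e4 : (2 * M) * (Real.pi * M) ≤ (2 * M) * (2 * (8 * Real.pi + 1) * (N' * R)) := by linarith
  have e5 := le_of_mul_le_mul_left e4 (by positivity)
  have e6 : 2 * (8 * Real.pi + 1) * (N' * R) ≤ Real.pi * (18 * (N' * R)) := by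
    have : 0 ≤ N' * R := by positivity
    nlinarith [Real.pi_gt_three]
  have e7 := le_of_mul_le_mul_left (e5.trans e6) Real.pi_pos
  have e8 : 18 * (N' * R) = 18 * R * N + η := by rw [hN']; field_simp
  linarith

lemma log_bound {R r : ℝ} (hr : 0 < r) (hrR : r ≤ R) :
    0 ≤ Real.log R - Real.log r ∧ r * (Real.log R - Real.log r) ^ 2 ≤ 4 * R := by
  have hR : 0 < R := hr.trans_le hrR
  have h0 : 0 ≤ Real.log R - Real.log r := by linarith [Real.log_le_log hr hrR]
  refine ⟨h0, ?_⟩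
  have hs : 0 < Real.sqrt (R / r) := Real.sqrt_pos.2 (by positivity)
  have h1 := Real.log_le_sub_one_of_pos hs
  rw [Real.log_sqrt (by positivity), Real.log_div hR.ne' hr.ne'] at h1
  have h2 : Real.log R - Real.log r ≤ 2 * Real.sqrt (R / r) := by linarith
  have h3 : (Real.log R - Real.log r) ^ 2 ≤ 4 * (R / r) := by
    have := pow_le_pow_left₀ h0 h2 2
    rw [mul_pow, Real.sq_sqrt (by positivity)] at this
    linarith
  calc _ ≤ r * (4 * (R / r)) := by gcongr
    _ = 4 * R := by field_simp

lemma main_ineq {p : ℂ → ℝ} (hp : ContDiff ℝ 2 p) (hsub : ∀ z : ℂ, 0 ≤ lapR p z)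
    (τ : ℝ) (hτ : 0 < τ) {f : ℂ → ℂ} (hf : ContDiff ℝ 2 f) (w : ℂ) (R : ℝ) (hR : 0 < R)
    (hsupp : tsupport f ⊆ Metric.ball w R) (hmax : ∀ y, ‖f y‖ ≤ ‖f w‖) :
    ‖f w‖ ≤ 18 * R * Real.sqrt (∫ y, ‖Box p τ f y‖ ^ 2) := by
  have hN2 : 0 ≤ ∫ y, ‖Box p τ f y‖ ^ 2 := integral_nonneg fun y => by positivity
  have hout : ∀ y, R ≤ ‖y - w‖ → y ∉ tsupport f := by
    intro y hy hmem
    have := hsupp hmem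
    rw [Metric.mem_ball, dist_eq_norm] at this
    linarith
  have h0 : ∀ θ, (fun y => ‖f y‖ ^ 2) (w + R * ee θ) = 0 := by
    intro θ
    have : w + R * ee θ ∉ tsupport f := hout _ (by simp [norm_ee, abs_of_pos hR])
    simp [image_eq_zero_of_notMem_tsupport this]
  obtain ⟨hi, hint⟩ := polar_green (fun y => ‖f y‖ ^ 2) (hf.norm_sq ℝ) w R hR h0
  have hpol := polar_int (fun y => ‖Box p τ f y‖ ^ 2) w R (fun y hy => by
    simp [Box_zero hp τ hf y (hout y hy.le)])
  have hcB := continuous_Box hp τ hf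
  have hce := continuous_ee
  have hgi : Integrable (fun x : ℝ × ℝ => x.1 * ‖Box p τ f (w + x.1 * ee x.2)‖ ^ 2)
      ((nuR R).prod nuT) := by
    have := integrable_cont R (fun x : ℝ × ℝ => x.1 * ‖Box p τ f (w + x.1 * ee x.2)‖ ^ 2)
      (by fun_prop) (fun _ => 1) (integrable_const _)
    simpa using this
  refine final_bound (norm_nonneg _) hR (Real.sqrt_nonneg _) fun ε hε => ?_
  rw [Real.sq_sqrt hN2]
  set M := ‖f w‖ with hM
  have hM0 : 0 ≤ M := norm_nonneg _
  have hbi : Integrable (fun x : ℝ × ℝ => -(4 * M) * (4 * R * ε +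
      ε⁻¹ * (x.1 * ‖Box p τ f (w + x.1 * ee x.2)‖ ^ 2))) ((nuR R).prod nuT) :=
    ((integrable_const _).add (hgi.const_mul _)).const_mul _
  have hmono := integral_mono_ae hbi hi ?_
  · rw [hint, integral_const_mul, integral_add (integrable_const _) (hgi.const_mul _),
      integral_const, integral_const_mul, hpol] at hmono
    have hmass : ((nuR R).prod nuT).real Set.univ = R * (2 * Real.pi) := by
      rw [← Set.univ_prod_univ, measureReal_prod_prod]
      unfold nuR nuT
      simp [hR.le, Real.pi_pos.le]
      left
      ring
    rw [hmass, smul_eq_mul] at hmono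
    rw [div_eq_inv_mul]
    linarith
  · unfold nuR nuT
    rw [Measure.prod_restrict]
    refine ae_restrict_of_forall_mem (measurableSet_Ioc.prod measurableSet_Ioc) ?_
    rintro ⟨r, t⟩ ⟨⟨hr, hrR⟩, -⟩
    simp only at hr hrR ⊢
    obtain ⟨hl0, hl⟩ := log_bound hr hrR
    set y := w + r * ee t
    set l := Real.log R - Real.log r
    set g := ‖Box p τ f y‖ with hg
    have hg0 : 0 ≤ g := norm_nonneg _
    have hk := kato hp τ hτ hf y (hsub y)
    have hk2 : -(8 * M * g) ≤ lap2 (fun y => ‖f y‖ ^ 2) y := by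
      refine le_trans ?_ hk
      have := mul_le_mul_of_nonneg_right (hmax y) hg0
      rw [← hg]
      nlinarith
    have hlr : 0 ≤ l * r := by positivity
    have h1 := mul_le_mul_of_nonneg_left hk2 hlr
    have h2 : 2 * l * g ≤ ε * l ^ 2 + ε⁻¹ * g ^ 2 := by
      have : 0 ≤ ε⁻¹ * (ε * l - g) ^ 2 := by positivity
      have e : ε⁻¹ * (ε * l - g) ^ 2 = ε * l ^ 2 + ε⁻¹ * g ^ 2 - 2 * l * g := by
        field_simp; ring
      linarith
    have h3 : r * (2 * l * g) ≤ 4 * R * ε + ε⁻¹ * (r * g ^ 2) := by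
      calc _ ≤ r * (ε * l ^ 2 + ε⁻¹ * g ^ 2) := by gcongr
        _ = ε * (r * l ^ 2) + ε⁻¹ * (r * g ^ 2) := by ring
        _ ≤ ε * (4 * R) + ε⁻¹ * (r * g ^ 2) := by gcongr
        _ = _ := by ring
    have h4 := mul_le_mul_of_nonneg_left h3 (by positivity : 0 ≤ 4 * M)
    linarith

/-- Corollary `cor:sobolev`: pointwise bound at the center of a disk. -/
theorem statement3 (p : ℂ → ℝ) (hpoly : IsRealPoly p)
    (hsub : ∀ z : ℂ, 0 ≤ lapR p z) (hnonharm : ∃ z : ℂ, lapR p z ≠ 0) :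
    ∃ C : ℝ, 0 < C ∧ ∀ τ : ℝ, 0 < τ → ∀ δ : ℝ, 0 < δ → ∀ z : ℂ, ∀ f : ℂ → ℂ,
      ContDiff ℝ 2 f → tsupport f ⊆ Metric.ball z δ →
      ‖f z‖ ≤ (C / δ) * (Real.sqrt (∫ y in Metric.ball z δ, ‖f y‖ ^ 2)
        + δ ^ 2 * Real.sqrt (∫ y in Metric.ball z δ, ‖Box p τ f y‖ ^ 2)) := by
  have hp := contDiff_poly hpoly
  refine ⟨36, by norm_num, fun τ hτ δ hδ z f hf hsupp => ?_⟩
  have hcomp : HasCompactSupport f :=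
    (isCompact_closedBall z δ).of_isClosed_subset (isClosed_tsupport f)
      (hsupp.trans Metric.ball_subset_closedBall)
  have hset : ∫ y in Metric.ball z δ, ‖Box p τ f y‖ ^ 2 = ∫ y, ‖Box p τ f y‖ ^ 2 := by
    apply setIntegral_eq_integral_of_forall_compl_eq_zero
    intro y hy
    simp [Box_zero hp τ hf y (fun h => hy (hsupp h))]
  rw [hset]
  set N := Real.sqrt (∫ y, ‖Box p τ f y‖ ^ 2)
  have hN : 0 ≤ N := Real.sqrt_nonneg _
  have hmain : ‖f z‖ ≤ 36 * δ * N := by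
    obtain ⟨w, hw⟩ := (hf.continuous.norm).exists_forall_ge_of_hasCompactSupport hcomp.norm
    by_cases hfw : f w = 0
    · have := hw z
      rw [hfw, norm_zero] at this
      exact this.trans (by positivity)
    · have hwz : w ∈ Metric.ball z δ := hsupp (subset_tsupport f hfw)
      have h2 : tsupport f ⊆ Metric.ball w (2 * δ) := by
        intro y hy
        have h3 := hsupp hy
        rw [Metric.mem_ball] at *
        have := dist_triangle_right y w z
        linarith
      have := main_ineq hp hsub τ hτ hf w (2 * δ) (by positivity) h2 hw
      calc _ ≤ _ := hw z
        _ ≤ _ := this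
        _ = _ := by ring
  have e : 36 / δ * (Real.sqrt (∫ y in Metric.ball z δ, ‖f y‖ ^ 2) + δ ^ 2 * N) =
      36 / δ * Real.sqrt (∫ y in Metric.ball z δ, ‖f y‖ ^ 2) + 36 * δ * N := by
    field_simp
  rw [e]
  have : 0 ≤ 36 / δ * Real.sqrt (∫ y in Metric.ball z δ, ‖f y‖ ^ 2) := by positivity
  linarith

end
end

section
/- There exists a constant C > 0, depending only on p, such that for every τ > 0 and all z, w ∈ ℂ with |z − w| > μ_p(w, 1/τ), one has μ_p(z,1/τ)/μ_p(w,1/τ) + μ_p(w,1/τ)/μ_p(z,1/τ) ≤ C ( |z − w| / μ_p(w,1/τ) )^{deg p}, where deg p is the degree of the polynomial p. -/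
open MeasureTheory Complex

noncomputable section

lemma taylor_exists (P : MvPolynomial (Fin 2) ℝ) (p : ℂ → ℝ)
    (hpoly : ∀ z : ℂ, p z = MvPolynomial.eval ![z.re, z.im] P) (w : ℂ) :
    ∃ c : ℕ × ℕ → ℂ, (∀ i, P.totalDegree < i.1 + i.2 → c i = 0) ∧
      ∀ u : ℂ, (p u : ℂ) =
        ∑ i ∈ Finset.range (P.totalDegree + 1) ×ˢ Finset.range (P.totalDegree + 1),
          c i * (u - w) ^ i.1 * (starRingEnd ℂ (u - w)) ^ i.2 := by
  classical
  set g : Fin 2 → MvPolynomial (Fin 2) ℂ :=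
    ![MvPolynomial.C (w.re : ℂ) + MvPolynomial.C (1/2 : ℂ) * (MvPolynomial.X 0 + MvPolynomial.X 1),
      MvPolynomial.C (w.im : ℂ) + MvPolynomial.C (-I/2 : ℂ) * (MvPolynomial.X 0 - MvPolynomial.X 1)] with hg
  have hg1 : ∀ i, (g i).totalDegree ≤ 1 := by
    intro i
    fin_cases i
    · simp only [hg]
      refine (MvPolynomial.totalDegree_add _ _).trans ?_
      refine max_le (by simp) ?_
      refine (MvPolynomial.totalDegree_mul _ _).trans ?_
      rw [MvPolynomial.totalDegree_C, zero_add]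
      refine (MvPolynomial.totalDegree_add _ _).trans ?_
      simp
    · simp only [hg]
      refine (MvPolynomial.totalDegree_add _ _).trans ?_
      refine max_le (by simp) ?_
      refine (MvPolynomial.totalDegree_mul _ _).trans ?_
      rw [MvPolynomial.totalDegree_C, zero_add]
      refine (MvPolynomial.totalDegree_sub _ _).trans ?_
      simp
  set Q : MvPolynomial (Fin 2) ℂ := MvPolynomial.aeval g P with hQ
  have hdeg : Q.totalDegree ≤ P.totalDegree := by
    rw [hQ, MvPolynomial.aeval_def, MvPolynomial.eval₂_eq']
    refine (MvPolynomial.totalDegree_finsetSum _ _).trans ?_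
    refine Finset.sup_le fun s hs => ?_
    have h1 := MvPolynomial.le_totalDegree hs
    refine (MvPolynomial.totalDegree_mul _ _).trans ?_
    have : (algebraMap ℝ (MvPolynomial (Fin 2) ℂ) (MvPolynomial.coeff s P)).totalDegree = 0 := by
      rw [MvPolynomial.algebraMap_apply]
      simp
    rw [this, zero_add]
    refine (MvPolynomial.totalDegree_finsetProd _ _).trans ?_
    refine le_trans ?_ h1
    rw [Finsupp.sum_fintype _ _ (by simp)]
    refine Finset.sum_le_sum fun i _ => ?_
    refine (MvPolynomial.totalDegree_pow _ _).trans ?_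
    simpa using Nat.mul_le_mul_left (s i) (hg1 i)
  have heval : ∀ u : ℂ, (p u : ℂ) = MvPolynomial.eval ![u - w, starRingEnd ℂ (u - w)] Q := by
    intro u
    rw [hpoly, hQ, MvPolynomial.aeval_def, MvPolynomial.eval₂_eq', MvPolynomial.eval_eq']
    simp only [map_sum, map_mul, map_pow, Fin.prod_univ_two]
    push_cast
    refine Finset.sum_congr rfl fun s _ => ?_
    have e0 : MvPolynomial.eval ![u - w, starRingEnd ℂ (u - w)] (g 0) = (u.re : ℂ) := by
      simp [hg]
      apply Complex.ext <;> simp 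
      ring
    have e1 : MvPolynomial.eval ![u - w, starRingEnd ℂ (u - w)] (g 1) = (u.im : ℂ) := by
      simp [hg]
      apply Complex.ext <;> simp
      ring
    have e2 : MvPolynomial.eval ![u - w, starRingEnd ℂ (u - w)]
        (algebraMap ℝ (MvPolynomial (Fin 2) ℂ) (MvPolynomial.coeff s P))
        = ((MvPolynomial.coeff s P : ℝ) : ℂ) := by
      rw [MvPolynomial.algebraMap_apply]
      simp
    rw [e0, e1, e2]
  refine ⟨fun i => MvPolynomial.coeff (Finsupp.single 0 i.1 + Finsupp.single 1 i.2) Q, ?_, ?_⟩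
  · intro i hi
    by_contra hne
    have h1 := MvPolynomial.le_totalDegree (MvPolynomial.mem_support_iff.mpr hne)
    rw [Finsupp.sum_fintype _ _ (by simp)] at h1
    simp [Fin.sum_univ_two] at h1
    omega
  · intro u
    rw [heval, MvPolynomial.eval_eq']
    have hs2 : ∀ s : Fin 2 →₀ ℕ, Finsupp.single 0 (s 0) + Finsupp.single 1 (s 1) = s := by
      intro s
      ext i
      fin_cases i <;> simp
    refine Finset.sum_of_injOn (fun s => (s 0, s 1)) ?_ ?_ ?_ ?_
    · intro s _ t _ h
      simp only [Prod.mk.injEq] at h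
      rw [← hs2 s, ← hs2 t, h.1, h.2]
    · intro s hs
      have h1 := MvPolynomial.le_totalDegree (Finset.mem_coe.mp hs)
      rw [Finsupp.sum_fintype _ _ (by simp)] at h1
      simp [Fin.sum_univ_two] at h1
      simp
      omega
    · rintro ⟨a, b⟩ _ h
      have : MvPolynomial.coeff (Finsupp.single 0 a + Finsupp.single 1 b) Q = 0 := by
        by_contra hne
        exact h ⟨_, Finset.mem_coe.mpr (MvPolynomial.mem_support_iff.mpr hne), by simp⟩
      simp [this]
    · intro s _
      simp only [hs2, Fin.prod_univ_two]
      simp [mul_assoc]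

lemma hasF (a w u : ℂ) (e g : ℕ) :
    HasFDerivAt (𝕜 := ℝ) (fun u : ℂ => a * (u - w) ^ e * (starRingEnd ℂ (u - w)) ^ g)
      ((a * e * (u - w) ^ (e - 1) * (starRingEnd ℂ (u - w)) ^ g) • (ContinuousLinearMap.id ℝ ℂ)
        + (a * g * (u - w) ^ e * (starRingEnd ℂ (u - w)) ^ (g - 1)) •
          (Complex.conjCLE : ℂ →L[ℝ] ℂ)) u := by
  have h1 : HasFDerivAt (𝕜 := ℝ) (fun u : ℂ => u - w) (ContinuousLinearMap.id ℝ ℂ) u :=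
    (hasFDerivAt_id u).sub_const w
  have h2 : HasFDerivAt (𝕜 := ℝ) (fun u : ℂ => starRingEnd ℂ (u - w))
      (Complex.conjCLE : ℂ →L[ℝ] ℂ) u := by
    have := (Complex.conjCLE : ℂ →L[ℝ] ℂ).hasFDerivAt (x := u - w)
    exact this.comp u h1
  have h3 := ((h1.pow e).const_mul a).mul (h2.pow g)
  refine h3.congr_fderiv ?_
  ext v
  all_goals simp
  all_goals ring

def Eb (S : Finset (ℕ × ℕ)) (a : ℕ × ℕ → ℂ) (e g : ℕ × ℕ → ℕ) (w u : ℂ) : ℂ :=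
  ∑ i ∈ S, a i * (u - w) ^ e i * (starRingEnd ℂ (u - w)) ^ g i

lemma fderiv_Eb (S : Finset (ℕ × ℕ)) (a : ℕ × ℕ → ℂ) (e g : ℕ × ℕ → ℕ) (w u v : ℂ) :
    fderiv ℝ (Eb S a e g w) u v = ∑ i ∈ S,
      ((a i * e i * (u - w) ^ (e i - 1) * (starRingEnd ℂ (u - w)) ^ g i) * v +
      (a i * g i * (u - w) ^ e i * (starRingEnd ℂ (u - w)) ^ (g i - 1)) * starRingEnd ℂ v) := by
  have h := HasFDerivAt.fun_sum (u := S) (fun i _ => hasF (a i) w u (e i) (g i))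
  have h' : HasFDerivAt (Eb S a e g w) _ u := h
  rw [h'.fderiv]
  simp

lemma Wz_Eb (S : Finset (ℕ × ℕ)) (a : ℕ × ℕ → ℂ) (e g : ℕ × ℕ → ℕ) (w : ℂ) :
    Wz (Eb S a e g w) = Eb S (fun i => a i * e i) (fun i => e i - 1) g w := by
  funext u
  simp only [Wz, pd₁, pd₂, fderiv_Eb, Eb, Finset.mul_sum, ← Finset.sum_sub_distrib]
  refine Finset.sum_congr rfl fun i _ => ?_
  simp only [map_one, conj_I]
  linear_combination (-(1/2) * (a i * e i * (u - w) ^ (e i - 1) * (starRingEnd ℂ (u - w)) ^ g i) + (1/2) * (a i * g i * (u - w) ^ e i * (starRingEnd ℂ (u - w)) ^ (g i - 1))) * I_mul_I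

lemma Wzb_Eb (S : Finset (ℕ × ℕ)) (a : ℕ × ℕ → ℂ) (e g : ℕ × ℕ → ℕ) (w : ℂ) :
    Wzb (Eb S a e g w) = Eb S (fun i => a i * g i) e (fun i => g i - 1) w := by
  funext u
  simp only [Wzb, pd₁, pd₂, fderiv_Eb, Eb, Finset.mul_sum, ← Finset.sum_add_distrib]
  refine Finset.sum_congr rfl fun i _ => ?_
  simp only [map_one, conj_I]
  linear_combination ((1/2) * (a i * e i * (u - w) ^ (e i - 1) * (starRingEnd ℂ (u - w)) ^ g i) - (1/2) * (a i * g i * (u - w) ^ e i * (starRingEnd ℂ (u - w)) ^ (g i - 1))) * I_mul_I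

lemma Wz_iter (S : Finset (ℕ × ℕ)) (a : ℕ × ℕ → ℂ) (e g : ℕ × ℕ → ℕ) (w : ℂ) (j : ℕ) :
    Wz^[j] (Eb S a e g w) =
      Eb S (fun i => a i * (e i).descFactorial j) (fun i => e i - j) g w := by
  induction j with
  | zero => simp
  | succ j ih =>
    rw [Function.iterate_succ_apply', ih, Wz_Eb]
    congr 1
    funext i
    rw [Nat.descFactorial_succ]
    push_cast
    ring

lemma Wzb_iter (S : Finset (ℕ × ℕ)) (a : ℕ × ℕ → ℂ) (e g : ℕ × ℕ → ℕ) (w : ℂ) (j : ℕ) :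
    Wzb^[j] (Eb S a e g w) =
      Eb S (fun i => a i * (g i).descFactorial j) e (fun i => g i - j) w := by
  induction j with
  | zero => simp
  | succ j ih =>
    rw [Function.iterate_succ_apply', ih, Wzb_Eb]
    congr 1
    funext i
    rw [Nat.descFactorial_succ]
    push_cast
    ring

lemma Ajk_Eb (p : ℂ → ℝ) (S : Finset (ℕ × ℕ)) (c : ℕ × ℕ → ℂ) (w : ℂ)
    (h : ∀ u : ℂ, (p u : ℂ) = ∑ i ∈ S, c i * (u - w) ^ i.1 * (starRingEnd ℂ (u - w)) ^ i.2)
    (j k : ℕ) (z : ℂ) :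
    Ajk p j k z = ∑ i ∈ S, (i.1.choose j * i.2.choose k : ℂ) * c i * (z - w) ^ (i.1 - j) *
      (starRingEnd ℂ (z - w)) ^ (i.2 - k) := by
  have h0 : (fun u => (p u : ℂ)) = Eb S c Prod.fst Prod.snd w := funext h
  rw [Ajk, h0, Wzb_iter, Wz_iter, Eb, Finset.mul_sum]
  refine Finset.sum_congr rfl fun i _ => ?_
  rw [Nat.descFactorial_eq_factorial_mul_choose, Nat.descFactorial_eq_factorial_mul_choose]
  push_cast
  have h1 : (j.factorial : ℂ) ≠ 0 := by exact_mod_cast j.factorial_ne_zero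
  have h2 : (k.factorial : ℂ) ≠ 0 := by exact_mod_cast k.factorial_ne_zero
  field_simp

lemma Ajk_self (p : ℂ → ℝ) (S : Finset (ℕ × ℕ)) (c : ℕ × ℕ → ℂ) (w : ℂ)
    (h : ∀ u : ℂ, (p u : ℂ) = ∑ i ∈ S, c i * (u - w) ^ i.1 * (starRingEnd ℂ (u - w)) ^ i.2)
    (j k : ℕ) :
    Ajk p j k w = if (j, k) ∈ S then c (j, k) else 0 := by
  rw [Ajk_Eb p S c w h, ← Finset.sum_ite_eq S (j, k) c]
  refine Finset.sum_congr rfl fun i _ => ?_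
  split_ifs with hi
  · subst hi; simp
  · rcases lt_trichotomy i.1 j with h1 | h1 | h1
    · simp [Nat.choose_eq_zero_of_lt h1]
    · rcases lt_trichotomy i.2 k with h2 | h2 | h2
      · simp [Nat.choose_eq_zero_of_lt h2]
      · exact absurd (Prod.ext h1.symm h2.symm) hi
      · simp [Nat.sub_ne_zero_of_lt h2]
    · simp [Nat.sub_ne_zero_of_lt h1]

/-- degree bound and Taylor estimate. -/
lemma taylor_bound (P : MvPolynomial (Fin 2) ℝ) (p : ℂ → ℝ)
    (hpoly : ∀ z : ℂ, p z = MvPolynomial.eval ![z.re, z.im] P) (w : ℂ) :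
    (∀ j k, P.totalDegree < j + k → Ajk p j k w = 0) ∧
    ∀ j k z, ‖Ajk p j k z‖ ≤
      ∑ i ∈ Finset.range (P.totalDegree + 1) ×ˢ Finset.range (P.totalDegree + 1),
        if j ≤ i.1 ∧ k ≤ i.2 then
          4 ^ P.totalDegree * ‖Ajk p i.1 i.2 w‖ * ‖z - w‖ ^ (i.1 + i.2 - (j + k)) else 0 := by
  obtain ⟨c, hc, h⟩ := taylor_exists P p hpoly w
  refine ⟨fun j k hjk => ?_, fun j k z => ?_⟩
  · rw [Ajk_self p _ c w h]
    simp [hc (j, k) hjk]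
  · rw [Ajk_Eb p _ c w h j k z]
    refine (norm_sum_le _ _).trans (Finset.sum_le_sum fun i hi => ?_)
    split_ifs with hle
    · rw [Ajk_self p _ c w h, if_pos hi]
      simp only [norm_mul, norm_pow, RCLike.norm_conj, Complex.norm_natCast]
      have e : i.1 + i.2 - (j + k) = (i.1 - j) + (i.2 - k) := by omega
      rw [e, pow_add, ← mul_assoc]
      gcongr
      simp only [Finset.mem_product, Finset.mem_range] at hi
      have h1 : (i.1.choose j : ℝ) ≤ 2 ^ P.totalDegree := by
        exact_mod_cast (Nat.choose_le_two_pow i.1 j).trans (Nat.pow_le_pow_right (by norm_num) (by omega))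
      have h2 : (i.2.choose k : ℝ) ≤ 2 ^ P.totalDegree := by
        exact_mod_cast (Nat.choose_le_two_pow i.2 k).trans (Nat.pow_le_pow_right (by norm_num) (by omega))
      calc (i.1.choose j : ℝ) * i.2.choose k ≤ 2 ^ P.totalDegree * 2 ^ P.totalDegree := by gcongr
        _ = 4 ^ P.totalDegree := by rw [← mul_pow]; norm_num
    · rw [not_and_or] at hle
      rcases hle with h1 | h1
      · simp [Nat.choose_eq_zero_of_lt (not_le.mp h1)]
      · simp [Nat.choose_eq_zero_of_lt (not_le.mp h1)]

lemma contDiff_p (P : MvPolynomial (Fin 2) ℝ) (p : ℂ → ℝ)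
    (hpoly : ∀ z : ℂ, p z = MvPolynomial.eval ![z.re, z.im] P) : ContDiff ℝ 2 p := by
  have : p = fun z : ℂ => ∑ s ∈ P.support, P.coeff s * (z.re ^ s 0 * z.im ^ s 1) := by
    funext z
    rw [hpoly, MvPolynomial.eval_eq']
    simp [Fin.prod_univ_two]
  rw [this]
  have hre : ContDiff ℝ 2 (fun z : ℂ => z.re) := Complex.reCLM.contDiff
  have him : ContDiff ℝ 2 (fun z : ℂ => z.im) := Complex.imCLM.contDiff
  refine ContDiff.sum fun s _ => ?_
  exact contDiff_const.mul ((hre.pow _).mul (him.pow _))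

lemma fderiv_ofReal_s8 (f : ℂ → ℝ) (z v : ℂ) (hf : DifferentiableAt ℝ f z) :
    fderiv ℝ (fun w => (f w : ℂ)) z v = (fderiv ℝ f z v : ℝ) := by
  have h := (Complex.ofRealCLM.hasFDerivAt (x := f z)).comp z hf.hasFDerivAt
  have h' : HasFDerivAt (fun w => (f w : ℂ)) _ z := h
  rw [h'.fderiv]
  simp

lemma lap_eq (p : ℂ → ℝ) (hp : ContDiff ℝ 2 p) (z : ℂ) :
    lapR p z = 4 * (Ajk p 1 1 z).re := by
  have hd : Differentiable ℝ p := hp.differentiable (by norm_num)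
  have h1 : Differentiable ℝ (pdR₁ p) :=
    ((hp.fderiv_right (m := 1) (by norm_num)).clm_apply contDiff_const).differentiable (by norm_num)
  have h2 : Differentiable ℝ (pdR₂ p) :=
    ((hp.fderiv_right (m := 1) (by norm_num)).clm_apply contDiff_const).differentiable (by norm_num)
  have e1 : Wzb (fun w => (p w : ℂ)) =
      fun u => (1 / 2 : ℂ) * ((pdR₁ p u : ℂ) + I * (pdR₂ p u : ℂ)) := by
    funext u
    simp only [Wzb, pd₁, pd₂, fderiv_ofReal_s8 p u _ (hd u), pdR₁, pdR₂]
  have c1 : ∀ f : ℂ → ℝ, Differentiable ℝ f → Differentiable ℝ (fun w => (f w : ℂ)) :=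
    fun f hf => Complex.ofRealCLM.differentiable.comp hf
  have e2 : ∀ v, fderiv ℝ (Wzb (fun w => (p w : ℂ))) z v =
      (1/2 : ℂ) * ((fderiv ℝ (pdR₁ p) z v : ℝ) + I * (fderiv ℝ (pdR₂ p) z v : ℝ)) := by
    intro v
    have a1 := (c1 (pdR₁ p) h1 z).hasFDerivAt
    have a2 := (c1 (pdR₂ p) h2 z).hasFDerivAt
    have a3 := (a1.add (a2.const_mul I)).const_mul (1/2 : ℂ)
    have a4 : HasFDerivAt (𝕜 := ℝ) (Wzb (fun w => (p w : ℂ))) _ z :=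
      a3.congr_of_eventuallyEq (Filter.Eventually.of_forall fun u => by rw [e1]; rfl)
    rw [a4.fderiv]
    simp only [ContinuousLinearMap.smul_apply, ContinuousLinearMap.add_apply, smul_eq_mul,
      fderiv_ofReal_s8 _ z v (h1 z), fderiv_ofReal_s8 _ z v (h2 z)]
  simp only [Ajk, Function.iterate_one, Wz, pd₁, pd₂, e2, lapR]
  simp
  ring

lemma mu_le_prop (p : ℂ → ℝ) (w : ℂ) (δ : ℝ) (hδ : 0 < δ) (hμ : 0 ≤ mu p w δ) (j k : ℕ)
    (hj : 1 ≤ j) (hk : 1 ≤ k) : ‖Ajk p j k w‖ * mu p w δ ^ (j + k) ≤ δ := by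
  by_cases h : Ajk p j k w = 0
  · simp [h, hδ.le]
  · have hb : BddBelow { r : ℝ | ∃ j k : ℕ, 1 ≤ j ∧ 1 ≤ k ∧ Ajk p j k w ≠ 0 ∧
        r = ‖(δ : ℂ) / Ajk p j k w‖ ^ (((j + k : ℕ) : ℝ))⁻¹ } := by
      refine ⟨0, ?_⟩
      rintro r ⟨_, _, _, _, _, rfl⟩
      positivity
    have h1 : mu p w δ ≤ _ := csInf_le hb ⟨j, k, hj, hk, h, rfl⟩
    have h2 := pow_le_pow_left₀ hμ h1 (j + k)
    rw [Real.rpow_inv_natCast_pow (norm_nonneg _) (by omega), norm_div, Complex.norm_real,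
      Real.norm_of_nonneg hδ.le, le_div_iff₀ (norm_pos_iff.mpr h)] at h2
    linarith

lemma le_mu_of (p : ℂ → ℝ) (w : ℂ) (δ ρ : ℝ) (hδ : 0 < δ) (hρ : 0 ≤ ρ)
    (hne : ∃ j k, 1 ≤ j ∧ 1 ≤ k ∧ Ajk p j k w ≠ 0)
    (H : ∀ j k, 1 ≤ j → 1 ≤ k → ‖Ajk p j k w‖ * ρ ^ (j + k) ≤ δ) : ρ ≤ mu p w δ := by
  obtain ⟨j₀, k₀, h1, h2, h3⟩ := hne
  refine le_csInf ⟨_, j₀, k₀, h1, h2, h3, rfl⟩ ?_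
  rintro r ⟨j, k, hj, hk, h, rfl⟩
  have h4 := H j k hj hk
  rw [Real.le_rpow_inv_iff_of_pos hρ (norm_nonneg _) (by positivity), Real.rpow_natCast, norm_div,
    Complex.norm_real, Real.norm_of_nonneg hδ.le, le_div_iff₀ (norm_pos_iff.mpr h)]
  linarith

lemma exists_Ajk_ne (P : MvPolynomial (Fin 2) ℝ) (p : ℂ → ℝ)
    (hpoly : ∀ z : ℂ, p z = MvPolynomial.eval ![z.re, z.im] P)
    (hnonharm : ∃ z : ℂ, lapR p z ≠ 0) (w : ℂ) : ∃ j k, 1 ≤ j ∧ 1 ≤ k ∧ Ajk p j k w ≠ 0 := by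
  by_contra! hcon
  obtain ⟨z, hz⟩ := hnonharm
  apply hz
  rw [lap_eq p (contDiff_p P p hpoly)]
  have h := (taylor_bound P p hpoly w).2 1 1 z
  rw [Finset.sum_eq_zero] at h
  · rw [norm_le_zero_iff.mp h]; simp
  · intro i _
    split_ifs with hi
    · simp [hcon i.1 i.2 hi.1 hi.2]
    · rfl

lemma mu_pos (P : MvPolynomial (Fin 2) ℝ) (p : ℂ → ℝ)
    (hpoly : ∀ z : ℂ, p z = MvPolynomial.eval ![z.re, z.im] P)
    (hnonharm : ∃ z : ℂ, lapR p z ≠ 0) (w : ℂ) (δ : ℝ) (hδ : 0 < δ) : 0 < mu p w δ := by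
  set B : ℝ := 1 + ∑ i ∈ Finset.range (P.totalDegree + 1) ×ˢ Finset.range (P.totalDegree + 1),
    ‖Ajk p i.1 i.2 w‖ with hB
  have hS : 0 ≤ ∑ i ∈ Finset.range (P.totalDegree + 1) ×ˢ Finset.range (P.totalDegree + 1),
    ‖Ajk p i.1 i.2 w‖ := Finset.sum_nonneg fun _ _ => norm_nonneg _
  have hB1 : 1 ≤ B := by linarith
  have hρ : 0 < min 1 (δ / B) := lt_min one_pos (by positivity)
  refine hρ.trans_le (le_mu_of p w δ _ hδ hρ.le (exists_Ajk_ne P p hpoly hnonharm w) ?_)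
  intro j k hj hk
  by_cases hjk : P.totalDegree < j + k
  · simp [(taylor_bound P p hpoly w).1 j k hjk, hδ.le]
  · have h1 : ‖Ajk p j k w‖ ≤ B := by
      have := Finset.single_le_sum (f := fun i : ℕ × ℕ => ‖Ajk p i.1 i.2 w‖)
        (s := Finset.range (P.totalDegree + 1) ×ˢ Finset.range (P.totalDegree + 1))
        (fun _ _ => norm_nonneg _) (a := (j, k))
        (by simp only [Finset.mem_product, Finset.mem_range]; omega)
      simp only at this
      linarith
    have h2 : min 1 (δ / B) ^ (j + k) ≤ δ / B :=
      (pow_le_of_le_one hρ.le (min_le_left _ _) (by omega)).trans (min_le_right _ _)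
    calc ‖Ajk p j k w‖ * min 1 (δ / B) ^ (j + k) ≤ B * (δ / B) := by gcongr
      _ = δ := by field_simp

def Kd (d : ℕ) : ℝ := (d + 1) ^ 2 * 4 ^ d

lemma one_le_Kd (d : ℕ) : 1 ≤ Kd d := by
  unfold Kd
  have h1 : (1 : ℝ) ≤ (d + 1) ^ 2 := one_le_pow₀ (by linarith [Nat.cast_nonneg (α := ℝ) d])
  have h2 : (1 : ℝ) ≤ 4 ^ d := one_le_pow₀ (by norm_num)
  nlinarith

lemma key (P : MvPolynomial (Fin 2) ℝ) (p : ℂ → ℝ)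
    (hpoly : ∀ z : ℂ, p z = MvPolynomial.eval ![z.re, z.im] P)
    (hnonharm : ∃ z : ℂ, lapR p z ≠ 0) (z w : ℂ) (δ : ℝ) (hδ : 0 < δ) (R : ℝ)
    (hR : mu p w δ ≤ R) (hzw : ‖z - w‖ ≤ R) :
    R / (Kd P.totalDegree * (R / mu p w δ) ^ P.totalDegree) ≤ mu p z δ := by
  have hμ := mu_pos P p hpoly hnonharm w δ hδ
  set m := mu p w δ with hm
  set d := P.totalDegree with hd
  have hR0 : 0 < R := hμ.trans_le hR
  have hX : 1 ≤ R / m := (one_le_div hμ).mpr hR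
  have hK := one_le_Kd d
  set Y := Kd d * (R / m) ^ d with hY
  have hXd : 1 ≤ (R / m) ^ d := one_le_pow₀ hX
  have hY1 : 1 ≤ Y := by nlinarith
  refine le_mu_of p z δ _ hδ (by positivity) (exists_Ajk_ne P p hpoly hnonharm z) ?_
  intro j k hj hk
  have hb : ‖Ajk p j k z‖ ≤ δ * Y / R ^ (j + k) := by
    refine ((taylor_bound P p hpoly w).2 j k z).trans ?_
    have : δ * Y / R ^ (j + k) = ∑ i ∈ Finset.range (d + 1) ×ˢ Finset.range (d + 1),
        (4 ^ d * (δ * (R / m) ^ d / R ^ (j + k))) := by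
      rw [Finset.sum_const, Finset.card_product, Finset.card_range, nsmul_eq_mul, hY, Kd]
      push_cast
      ring
    rw [this]
    refine Finset.sum_le_sum fun i _ => ?_
    split_ifs with hi
    · rw [mul_assoc]
      gcongr
      by_cases hdi : d < i.1 + i.2
      · rw [(taylor_bound P p hpoly w).1 _ _ hdi]
        simp only [norm_zero, zero_mul]
        positivity
      · have h1 := mu_le_prop p w δ hδ hμ.le i.1 i.2 (hj.trans hi.1) (hk.trans hi.2)
        rw [← hm] at h1
        rw [le_div_iff₀ (by positivity)]
        calc ‖Ajk p i.1 i.2 w‖ * ‖z - w‖ ^ (i.1 + i.2 - (j + k)) * R ^ (j + k)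
            ≤ ‖Ajk p i.1 i.2 w‖ * R ^ (i.1 + i.2 - (j + k)) * R ^ (j + k) := by gcongr
          _ = ‖Ajk p i.1 i.2 w‖ * R ^ (i.1 + i.2) := by
            rw [mul_assoc, ← pow_add, Nat.sub_add_cancel (by omega)]
          _ = (‖Ajk p i.1 i.2 w‖ * m ^ (i.1 + i.2)) * (R / m) ^ (i.1 + i.2) := by
            rw [div_pow]; field_simp
          _ ≤ δ * (R / m) ^ d := by
            gcongr
            omega
    · positivity
  calc ‖Ajk p j k z‖ * (R / Y) ^ (j + k) ≤ δ * Y / R ^ (j + k) * (R / Y) ^ (j + k) := by gcongr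
    _ = δ * (Y / Y ^ (j + k)) := by rw [div_pow]; field_simp
    _ ≤ δ * 1 := by
      gcongr
      rw [div_le_one (by positivity)]
      exact le_self_pow₀ hY1 (by omega)
    _ = δ := mul_one _

/-- Lemma `lem:3.3 Christ`: comparability of `μ_p(z,1/τ)` and `μ_p(w,1/τ)`. -/
theorem statement8 (P : MvPolynomial (Fin 2) ℝ) (p : ℂ → ℝ)
    (hpoly : ∀ z : ℂ, p z = MvPolynomial.eval ![z.re, z.im] P)
    (hsub : ∀ z : ℂ, 0 ≤ lapR p z) (hnonharm : ∃ z : ℂ, lapR p z ≠ 0) :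
    ∃ C : ℝ, 0 < C ∧ ∀ τ : ℝ, 0 < τ → ∀ z w : ℂ, mu p w (1 / τ) < ‖z - w‖ →
      mu p z (1 / τ) / mu p w (1 / τ) + mu p w (1 / τ) / mu p z (1 / τ)
        ≤ C * (‖z - w‖ / mu p w (1 / τ)) ^ P.totalDegree := by
  refine ⟨2 * Kd P.totalDegree, by linarith [one_le_Kd P.totalDegree], ?_⟩
  intro τ hτ z w hzw
  have hδ : 0 < 1 / τ := by positivity
  generalize 1 / τ = δ at hδ hzw ⊢
  have hw := mu_pos P p hpoly hnonharm w δ hδ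
  have hz := mu_pos P p hpoly hnonharm z δ hδ
  have hK := one_le_Kd P.totalDegree
  have hd : P.totalDegree ≠ 0 := by
    obtain ⟨j, k, hj, hk, hne⟩ := exists_Ajk_ne P p hpoly hnonharm w
    intro h0
    exact hne ((taylor_bound P p hpoly w).1 j k (by omega))
  have k1 := key P p hpoly hnonharm z w δ hδ ‖z - w‖ hzw.le le_rfl
  have hX : 1 ≤ ‖z - w‖ / mu p w δ := (one_le_div hw).mpr hzw.le
  have hXd : 1 ≤ (‖z - w‖ / mu p w δ) ^ P.totalDegree := one_le_pow₀ hX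
  have b1 : mu p w δ / mu p z δ ≤
      Kd P.totalDegree * (‖z - w‖ / mu p w δ) ^ P.totalDegree := by
    rw [div_le_iff₀ (by positivity)] at k1
    rw [div_le_iff₀ hz]
    linarith
  have b2 : mu p z δ / mu p w δ ≤
      Kd P.totalDegree * (‖z - w‖ / mu p w δ) ^ P.totalDegree := by
    rcases le_total (mu p z δ) ‖z - w‖ with h | h
    · calc mu p z δ / mu p w δ ≤ ‖z - w‖ / mu p w δ := by gcongr
        _ ≤ (‖z - w‖ / mu p w δ) ^ P.totalDegree := le_self_pow₀ hX hd
        _ ≤ _ := le_mul_of_one_le_left (by positivity) hK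
    · have k2 := key P p hpoly hnonharm w z δ hδ (mu p z δ) le_rfl (by rwa [norm_sub_rev])
      rw [div_self hz.ne', one_pow, mul_one, div_le_iff₀ (by positivity)] at k2
      have : mu p z δ / mu p w δ ≤ Kd P.totalDegree := by
        rw [div_le_iff₀ hw]; linarith
      exact this.trans (le_mul_of_one_le_right (by positivity) hXd)
  linarith

end
end

section
/- For every c > 0 there exist constants C > 0 and c' with 0 < c' ≤ c, depending only on c and p, such that for every τ > 0 and all z, w ∈ ℂ with |z − w| ≥ μ_p(z, 1/τ), one has (1/μ_p(z,1/τ)) · exp(−c |z−w| / μ_p(z,1/τ)) ≤ C (1/μ_p(w,1/τ)) · exp(−c' |z−w| / μ_p(z,1/τ)). -/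
open MeasureTheory Complex

noncomputable section

open ComplexConjugate in
lemma mono_hasFDerivAt (w z : ℂ) (n m : ℕ) :
    HasFDerivAt (𝕜 := ℝ) (fun z : ℂ => (z - w) ^ n * (conj (z - w)) ^ m)
      (((z - w) ^ n) • ((m * (conj (z - w)) ^ (m - 1)) • (Complex.conjCLE : ℂ →L[ℝ] ℂ)) +
        ((conj (z - w)) ^ m) • ((n * (z - w) ^ (n - 1)) • ContinuousLinearMap.id ℝ ℂ)) z := by
  have h1 : HasFDerivAt (𝕜 := ℝ) (fun z : ℂ => z - w) (ContinuousLinearMap.id ℝ ℂ) z :=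
    (hasFDerivAt_id z).sub_const w
  have h2 : HasFDerivAt (𝕜 := ℝ) (fun z : ℂ => conj (z - w))
      (Complex.conjCLE : ℂ →L[ℝ] ℂ) z := by
    have := (Complex.conjCLE : ℂ →L[ℝ] ℂ).hasFDerivAt.comp z h1
    simpa [Function.comp_def] using this
  have h3 := (h1.pow n).mul (h2.pow m)
  refine h3.congr_fderiv ?_
  ext <;> simp <;> ring

open ComplexConjugate in
lemma sum_hasFDerivAt (w z : ℂ) (s : Finset (ℕ × ℕ)) (c : ℕ × ℕ → ℂ) (e f : ℕ × ℕ → ℕ) :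
    HasFDerivAt (𝕜 := ℝ) (fun z : ℂ => ∑ i ∈ s, c i * ((z - w) ^ e i * (conj (z - w)) ^ f i))
      (∑ i ∈ s, c i • (((z - w) ^ e i) • ((f i * (conj (z - w)) ^ (f i - 1)) •
        (Complex.conjCLE : ℂ →L[ℝ] ℂ)) +
        ((conj (z - w)) ^ f i) • ((e i * (z - w) ^ (e i - 1)) • ContinuousLinearMap.id ℝ ℂ))) z := by
  refine HasFDerivAt.fun_sum fun i _ => ?_
  exact (mono_hasFDerivAt w z (e i) (f i)).const_mul (c i)

open ComplexConjugate in
lemma Wz_sum (w : ℂ) (s : Finset (ℕ × ℕ)) (c : ℕ × ℕ → ℂ) (e f : ℕ × ℕ → ℕ) :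
    Wz (fun z : ℂ => ∑ i ∈ s, c i * ((z - w) ^ e i * (conj (z - w)) ^ f i)) =
      fun z => ∑ i ∈ s, (c i * e i) * ((z - w) ^ (e i - 1) * (conj (z - w)) ^ f i) := by
  funext z
  simp only [Wz, pd₁, pd₂, (sum_hasFDerivAt w z s c e f).fderiv, ContinuousLinearMap.sum_apply,
    Finset.mul_sum, ← Finset.sum_sub_distrib]
  refine Finset.sum_congr rfl fun i _ => ?_
  simp
  ring_nf
  simp
  ring

open ComplexConjugate in
lemma Wzb_sum (w : ℂ) (s : Finset (ℕ × ℕ)) (c : ℕ × ℕ → ℂ) (e f : ℕ × ℕ → ℕ) :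
    Wzb (fun z : ℂ => ∑ i ∈ s, c i * ((z - w) ^ e i * (conj (z - w)) ^ f i)) =
      fun z => ∑ i ∈ s, (c i * f i) * ((z - w) ^ e i * (conj (z - w)) ^ (f i - 1)) := by
  funext z
  simp only [Wzb, pd₁, pd₂, (sum_hasFDerivAt w z s c e f).fderiv, ContinuousLinearMap.sum_apply,
    Finset.mul_sum, ← Finset.sum_add_distrib]
  refine Finset.sum_congr rfl fun i _ => ?_
  simp
  ring_nf
  simp
  ring

open ComplexConjugate in
lemma iter_sum (w : ℂ) (s : Finset (ℕ × ℕ)) (c : ℕ × ℕ → ℂ) (j k : ℕ) :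
    Wz^[j] (Wzb^[k] (fun z : ℂ => ∑ i ∈ s, c i * ((z - w) ^ i.1 * (conj (z - w)) ^ i.2))) =
      fun z => ∑ i ∈ s, (c i * (i.1.descFactorial j * i.2.descFactorial k : ℕ)) *
        ((z - w) ^ (i.1 - j) * (conj (z - w)) ^ (i.2 - k)) := by
  induction j with
  | zero =>
    induction k with
    | zero => simp
    | succ k ih =>
      simp only [Function.iterate_zero, id_eq, Function.iterate_succ_apply'] at ih ⊢
      rw [ih, Wzb_sum w s _ (fun i => i.1 - 0) (fun i => i.2 - k)]
      funext z
      refine Finset.sum_congr rfl fun i _ => ?_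
      rw [Nat.descFactorial_succ, Nat.sub_sub]
      push_cast
      ring
  | succ j ih =>
    rw [Function.iterate_succ_apply', ih, Wz_sum w s _ (fun i => i.1 - j) (fun i => i.2 - k)]
    funext z
    refine Finset.sum_congr rfl fun i _ => ?_
    rw [Nat.descFactorial_succ, Nat.sub_sub]
    push_cast
    ring

open ComplexConjugate in
lemma Ajk_sum (p : ℂ → ℝ) (w : ℂ) (s : Finset (ℕ × ℕ)) (c : ℕ × ℕ → ℂ)
    (h : ∀ z, (p z : ℂ) = ∑ i ∈ s, c i * ((z - w) ^ i.1 * (conj (z - w)) ^ i.2)) (j k : ℕ) (z : ℂ) :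
    Ajk p j k z = ∑ i ∈ s, (c i * (i.1.choose j * i.2.choose k : ℕ)) *
        ((z - w) ^ (i.1 - j) * (conj (z - w)) ^ (i.2 - k)) := by
  rw [Ajk, funext h, iter_sum, Finset.mul_sum]
  refine Finset.sum_congr rfl fun i _ => ?_
  rw [Nat.descFactorial_eq_factorial_mul_choose, Nat.descFactorial_eq_factorial_mul_choose]
  have h1 : (j.factorial : ℂ) ≠ 0 := by exact_mod_cast j.factorial_ne_zero
  have h2 : (k.factorial : ℂ) ≠ 0 := by exact_mod_cast k.factorial_ne_zero
  push_cast
  field_simp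

open ComplexConjugate in
lemma Ajk_center (p : ℂ → ℝ) (w : ℂ) (s : Finset (ℕ × ℕ)) (c : ℕ × ℕ → ℂ)
    (h : ∀ z, (p z : ℂ) = ∑ i ∈ s, c i * ((z - w) ^ i.1 * (conj (z - w)) ^ i.2)) (j k : ℕ) :
    Ajk p j k w = if (j, k) ∈ s then c (j, k) else 0 := by
  have key : ∀ i : ℕ × ℕ, i ≠ (j, k) → (c i * (i.1.choose j * i.2.choose k : ℕ)) *
        ((w - w) ^ (i.1 - j) * (conj (w - w)) ^ (i.2 - k)) = 0 := by
    rintro ⟨a, b⟩ hi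
    rcases lt_trichotomy a j with h1 | h1 | h1
    · simp [Nat.choose_eq_zero_of_lt h1]
    · rcases lt_trichotomy b k with h2 | h2 | h2
      · simp [Nat.choose_eq_zero_of_lt h2]
      · exact absurd (by rw [h1, h2]) hi
      · have : b - k ≠ 0 := by omega
        simp [this]
    · have : a - j ≠ 0 := by omega
      simp [this]
  rw [Ajk_sum p w s c h]
  split_ifs with hs
  · rw [Finset.sum_eq_single_of_mem _ hs fun i _ hi => key i hi]
    simp
  · exact Finset.sum_eq_zero fun i hi => key i (by rintro rfl; exact hs hi)

open ComplexConjugate Polynomial in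
lemma exists_bipoly (P : MvPolynomial (Fin 2) ℝ) :
    ∃ q : ℂ[X][X], ∀ z : ℂ,
      ((MvPolynomial.eval ![z.re, z.im] P : ℝ) : ℂ) = (q.eval (C z)).eval (conj z) := by
  induction P using MvPolynomial.induction_on with
  | C a => exact ⟨C (C (a : ℂ)), fun z => by simp⟩
  | add f g hf hg =>
    obtain ⟨q, hq⟩ := hf
    obtain ⟨r, hr⟩ := hg
    exact ⟨q + r, fun z => by simp [hq, hr]⟩
  | mul_X f n hf =>
    obtain ⟨q, hq⟩ := hf
    fin_cases n
    · refine ⟨q * (C (C (1 / 2)) * (X + C X)), fun z => ?_⟩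
      have : (z.re : ℂ) = 1 / 2 * (z + conj z) := by
        rw [Complex.add_conj]; push_cast; ring
      simp [hq, this]
    · refine ⟨q * (C (C (-Complex.I / 2)) * (X - C X)), fun z => ?_⟩
      have : (z.im : ℂ) = -Complex.I / 2 * (z - conj z) := by
        rw [Complex.sub_conj]; push_cast
        linear_combination (z.im : ℂ) * Complex.I_mul_I
      simp [hq, this]

open ComplexConjugate Polynomial in
lemma exists_zero_expansion (p : ℂ → ℝ) (hp : IsRealPoly p) :
    ∃ (N : ℕ) (c : ℕ × ℕ → ℂ), ∀ z, (p z : ℂ) =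
      ∑ i ∈ Finset.range N ×ˢ Finset.range N, c i * (z ^ i.1 * (conj z) ^ i.2) := by
  obtain ⟨P, hP⟩ := hp
  obtain ⟨q, hq⟩ := exists_bipoly P
  let N := q.natDegree + 1 + (q.support.sup fun n => (q.coeff n).natDegree)
  refine ⟨N, fun i => (q.coeff i.1).coeff i.2, fun z => ?_⟩
  rw [hP, hq, Polynomial.eval_eq_sum_range' (p := q) (n := N) (by omega), Polynomial.eval_finsetSum,
    Finset.sum_product]
  refine Finset.sum_congr rfl fun a _ => ?_
  have hd : (q.coeff a).natDegree < N := by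
    by_cases ha : a ∈ q.support
    · have := Finset.le_sup (f := fun n => (q.coeff n).natDegree) ha
      omega
    · rw [Polynomial.notMem_support_iff.1 ha]; simp [N]
  rw [← C_pow, Polynomial.eval_mul, Polynomial.eval_C, Polynomial.eval_eq_sum_range' hd, Finset.sum_mul]
  refine Finset.sum_congr rfl fun b _ => ?_
  ring

lemma pow_expand (N a : ℕ) (ha : a < N) (z w : ℂ) :
    z ^ a = ∑ i ∈ Finset.range N, (a.choose i : ℂ) * w ^ (a - i) * (z - w) ^ i := by
  have h := add_pow (z - w) w a
  rw [sub_add_cancel] at h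
  rw [h]
  rw [← Finset.sum_subset (Finset.range_mono (show a + 1 ≤ N by omega))]
  · refine Finset.sum_congr rfl fun i _ => ?_
    ring
  · intro i _ hi
    have : a < i := by simpa using hi
    simp [Nat.choose_eq_zero_of_lt this]

open ComplexConjugate in
lemma exists_expansion (p : ℂ → ℝ) (hp : IsRealPoly p) :
    ∃ N : ℕ, ∀ w : ℂ, ∃ c : ℕ × ℕ → ℂ, ∀ z, (p z : ℂ) =
      ∑ i ∈ Finset.range N ×ˢ Finset.range N, c i * ((z - w) ^ i.1 * (conj (z - w)) ^ i.2) := by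
  obtain ⟨N, c, h⟩ := exists_zero_expansion p hp
  refine ⟨N, fun w => ⟨fun i => ∑ a ∈ Finset.range N ×ˢ Finset.range N, c a *
    (((a.1.choose i.1 : ℂ) * w ^ (a.1 - i.1)) * ((a.2.choose i.2 : ℂ) * conj w ^ (a.2 - i.2))),
    fun z => ?_⟩⟩
  rw [h]
  simp only [Finset.sum_mul]
  rw [Finset.sum_comm]
  refine Finset.sum_congr rfl fun a ha => ?_
  simp only [Finset.mem_product, Finset.mem_range] at ha
  rw [pow_expand N a.1 ha.1 z w, pow_expand N a.2 ha.2 (conj z) (conj w), Finset.sum_mul_sum,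
    Finset.mul_sum, Finset.sum_product]
  refine Finset.sum_congr rfl fun i _ => ?_
  rw [Finset.mul_sum]
  refine Finset.sum_congr rfl fun j _ => ?_
  rw [map_sub]
  ring

/-- Key Taylor estimate. -/
lemma taylor_bound_s9 (p : ℂ → ℝ) (N : ℕ)
    (hN : ∀ w : ℂ, ∃ c : ℕ × ℕ → ℂ, ∀ z, (p z : ℂ) =
      ∑ i ∈ Finset.range N ×ˢ Finset.range N,
        c i * ((z - w) ^ i.1 * ((starRingEnd ℂ) (z - w)) ^ i.2))
    (z w : ℂ) (m : ℝ) (hm : 0 ≤ m)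
    (hw : ∀ a b : ℕ, 1 ≤ a → 1 ≤ b → ‖Ajk p a b w‖ * ‖z - w‖ ^ (a + b) ≤ m)
    (j k : ℕ) (hj : 1 ≤ j) (hk : 1 ≤ k) :
    ‖Ajk p j k z‖ * ‖z - w‖ ^ (j + k) ≤ (N * N * (2 ^ N * 2 ^ N)) * m := by
  obtain ⟨c, hc⟩ := hN w
  rw [Ajk_sum p w _ c hc]
  have hcard : ((Finset.range N ×ˢ Finset.range N).card : ℝ) = N * N := by simp
  rw [mul_assoc (N * N : ℝ), ← hcard, ← nsmul_eq_mul]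
  refine (mul_le_mul_of_nonneg_right (norm_sum_le _ _) (by positivity)).trans ?_
  rw [Finset.sum_mul]
  refine Finset.sum_le_card_nsmul _ _ _ ?_
  rintro ⟨a, b⟩ hab
  have hcab : c (a, b) = Ajk p a b w := by rw [Ajk_center p w _ c hc, if_pos hab]
  simp only [Finset.mem_product, Finset.mem_range] at hab
  simp only [hcab, norm_mul, norm_pow, RCLike.norm_conj, Complex.norm_natCast]
  by_cases h1 : a < j
  · simp [Nat.choose_eq_zero_of_lt h1]; positivity
  by_cases h2 : b < k
  · simp [Nat.choose_eq_zero_of_lt h2]; positivity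
  have e : a + b = (a - j) + (b - k) + (j + k) := by omega
  have h3 := hw a b (by omega) (by omega)
  have h4 : ((a.choose j * b.choose k : ℕ) : ℝ) ≤ 2 ^ N * 2 ^ N := by
    have u1 : a.choose j ≤ 2 ^ N :=
      (Nat.choose_le_two_pow a j).trans (Nat.pow_le_pow_right (by norm_num) hab.1.le)
    have u2 : b.choose k ≤ 2 ^ N :=
      (Nat.choose_le_two_pow b k).trans (Nat.pow_le_pow_right (by norm_num) hab.2.le)
    exact_mod_cast Nat.mul_le_mul u1 u2
  calc _ = ((a.choose j * b.choose k : ℕ) : ℝ) * (‖Ajk p a b w‖ * ‖z - w‖ ^ (a + b)) := by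
        rw [e]; ring
    _ ≤ _ := mul_le_mul h4 h3 (by positivity) (by positivity)

/-- The set in the definition of `mu`. -/
def muSet (p : ℂ → ℝ) (z : ℂ) (δ : ℝ) : Set ℝ :=
  { r : ℝ | ∃ j k : ℕ, 1 ≤ j ∧ 1 ≤ k ∧ Ajk p j k z ≠ 0 ∧
    r = ‖(δ : ℂ) / Ajk p j k z‖ ^ (((j + k : ℕ) : ℝ))⁻¹ }

lemma muSet_finite (p : ℂ → ℝ) (hp : IsRealPoly p) (z : ℂ) (δ : ℝ) : (muSet p z δ).Finite := by
  obtain ⟨N, hN⟩ := exists_expansion p hp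
  obtain ⟨c, hc⟩ := hN z
  refine (((Finset.range N ×ˢ Finset.range N).finite_toSet).image
    fun i : ℕ × ℕ => ‖(δ : ℂ) / Ajk p i.1 i.2 z‖ ^ (((i.1 + i.2 : ℕ) : ℝ))⁻¹).subset ?_
  rintro r ⟨j, k, _, _, h, rfl⟩
  refine ⟨(j, k), ?_, rfl⟩
  by_contra hn
  rw [Ajk_center p z _ c hc, if_neg (by simpa using hn)] at h
  exact h rfl

/-- estimate `eqn:mu(z) to mu(w)`. -/
theorem statement9 (p : ℂ → ℝ) (hpoly : IsRealPoly p)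
    (hsub : ∀ z : ℂ, 0 ≤ lapR p z) (hnonharm : ∃ z : ℂ, lapR p z ≠ 0)
    (c : ℝ) (hc : 0 < c) :
    ∃ C : ℝ, 0 < C ∧ ∃ c' : ℝ, 0 < c' ∧ c' ≤ c ∧
      ∀ τ : ℝ, 0 < τ → ∀ z w : ℂ, mu p z (1 / τ) ≤ ‖z - w‖ →
        (1 / mu p z (1 / τ)) * Real.exp (-c * ‖z - w‖ / mu p z (1 / τ))
          ≤ C * ((1 / mu p w (1 / τ)) * Real.exp (-c' * ‖z - w‖ / mu p z (1 / τ))) := by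
  obtain ⟨N, hN⟩ := exists_expansion p hpoly
  set K : ℝ := (N * N * (2 ^ N * 2 ^ N)) + 1 with hK
  have hK1 : 1 ≤ K := by rw [hK]; linarith [show (0 : ℝ) ≤ N * N * (2 ^ N * 2 ^ N) by positivity]
  refine ⟨2 * K / c, by positivity, c / 2, by positivity, by linarith, ?_⟩
  intro τ hτ z w hzw
  have hδ : 0 < 1 / τ := by positivity
  generalize 1 / τ = δ at hδ hzw ⊢
  have hmuw0 : 0 ≤ mu p w δ := by
    refine Real.sInf_nonneg ?_
    rintro r ⟨j, k, _, _, _, rfl⟩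
    positivity
  have hrhs : 0 ≤ 2 * K / c * ((1 / mu p w δ) * Real.exp (-(c / 2) * ‖z - w‖ / mu p z δ)) := by
    positivity
  rcases (muSet p z δ).eq_empty_or_nonempty with he | hne
  · have : mu p z δ = 0 := by
      change sInf (muSet p z δ) = 0
      rw [he, Real.sInf_empty]
    rw [this] at hrhs ⊢
    simpa using hrhs
  obtain ⟨j, k, hj, hk, hA, hr⟩ : sInf (muSet p z δ) ∈ muSet p z δ :=
    hne.csInf_mem (muSet_finite p hpoly z δ)
  change mu p z δ = _ at hr
  have hjk : ((j + k : ℕ) : ℝ) ≠ 0 := by positivity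
  have hrpos : 0 < mu p z δ := by
    rw [hr]
    have : (δ : ℂ) ≠ 0 := by exact_mod_cast hδ.ne'
    exact Real.rpow_pos_of_pos (norm_pos_iff.2 (div_ne_zero this (by assumption))) _
  have hpow : mu p z δ ^ (j + k) = δ / ‖Ajk p j k z‖ := by
    rw [hr, ← Real.rpow_natCast, ← Real.rpow_mul (norm_nonneg _), inv_mul_cancel₀ hjk,
      Real.rpow_one, norm_div, Complex.norm_of_nonneg hδ.le]
  have hlow : δ ≤ ‖Ajk p j k z‖ * ‖z - w‖ ^ (j + k) := by
    have h1 := pow_le_pow_left₀ hrpos.le hzw (j + k)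
    rw [hpow, div_le_iff₀ (norm_pos_iff.2 hA)] at h1
    linarith
  obtain ⟨a, b, ha, hb, hab⟩ : ∃ a b : ℕ, 1 ≤ a ∧ 1 ≤ b ∧
      δ / K < ‖Ajk p a b w‖ * ‖z - w‖ ^ (a + b) := by
    by_contra! hcon
    have h1 := taylor_bound_s9 p N hN z w (δ / K) (by positivity) hcon j k hj hk
    have h2 : (N * N * (2 ^ N * 2 ^ N) : ℝ) = K - 1 := by rw [hK]; ring
    rw [h2] at h1
    have h3 : (K - 1) * (δ / K) = δ - δ / K := by field_simp
    have h4 : 0 < δ / K := by positivity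
    linarith
  have hAw : Ajk p a b w ≠ 0 := by
    intro h0
    rw [h0, norm_zero, zero_mul] at hab
    exact absurd hab (not_lt.2 (by positivity))
  have hAwp := norm_pos_iff.2 hAw
  have hRpos : 0 < ‖z - w‖ := hrpos.trans_le hzw
  have hmem : ‖(δ : ℂ) / Ajk p a b w‖ ^ (((a + b : ℕ) : ℝ))⁻¹ ∈ muSet p w δ :=
    ⟨a, b, ha, hb, hAw, rfl⟩
  have hupp : mu p w δ ≤ K * ‖z - w‖ := by
    refine (csInf_le (muSet_finite p hpoly w δ).bddBelow hmem).trans ?_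
    rw [Real.rpow_inv_le_iff_of_pos (norm_nonneg _) (by positivity) (by positivity),
      Real.rpow_natCast, norm_div, Complex.norm_of_nonneg hδ.le, div_le_iff₀ hAwp, mul_pow]
    have h1 : K ≤ K ^ (a + b) := le_self_pow₀ hK1 (by omega)
    rw [div_lt_iff₀ (by positivity)] at hab
    calc δ ≤ K * (‖Ajk p a b w‖ * ‖z - w‖ ^ (a + b)) := by linarith
      _ ≤ K ^ (a + b) * (‖Ajk p a b w‖ * ‖z - w‖ ^ (a + b)) := by gcongr
      _ = _ := by ring
  have hwpos : 0 < mu p w δ := by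
    obtain ⟨j', k', hj', hk', hA', hr'⟩ : sInf (muSet p w δ) ∈ muSet p w δ :=
      Set.Nonempty.csInf_mem ⟨_, hmem⟩ (muSet_finite p hpoly w δ)
    change mu p w δ = _ at hr'
    rw [hr']
    have : (δ : ℂ) ≠ 0 := by exact_mod_cast hδ.ne'
    exact Real.rpow_pos_of_pos (norm_pos_iff.2 (div_ne_zero this (by assumption))) _
  generalize mu p z δ = r at *
  generalize mu p w δ = s at *
  generalize ‖z - w‖ = R at *
  have hexp : c / 2 * (R / r) ≤ Real.exp (c / 2 * (R / r)) := by
    linarith [Real.add_one_le_exp (c / 2 * (R / r))]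
  have e1 : Real.exp (-(c / 2) * R / r) =
      Real.exp (c / 2 * (R / r)) * Real.exp (-c * R / r) := by
    rw [← Real.exp_add]; congr 1; ring
  rw [e1]
  have e2 : 1 / r ≤ 2 * K / c * (1 / s * (c / 2 * (R / r))) := by
    have : 2 * K / c * (1 / s * (c / 2 * (R / r))) = (K * R / s) * (1 / r) := by
      field_simp
    rw [this]
    have h5 : 1 ≤ K * R / s := by rwa [one_le_div hwpos]
    exact le_mul_of_one_le_left (by positivity) h5
  calc 1 / r * Real.exp (-c * R / r)
      ≤ 2 * K / c * (1 / s * (c / 2 * (R / r))) * Real.exp (-c * R / r) := by gcongr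
    _ ≤ 2 * K / c * (1 / s * Real.exp (c / 2 * (R / r))) * Real.exp (-c * R / r) := by gcongr
    _ = _ := by ring

end
end

section
/- There exist constants c₁, c₂ > 0, depending only on p, such that for every z ∈ ℂ and every δ > 0: c₁ δ ≤ μ_p(z, Λ(z,δ)) ≤ c₂ δ and c₁ δ ≤ Λ(z, μ_p(z,δ)) ≤ c₂ δ; that is, for δ > 0 the function δ ↦ μ_p(z,δ) is an approximate inverse of δ ↦ Λ(z,δ). -/
open MeasureTheory Complex

noncomputable section

open MvPolynomial in
/-- Evaluation of a polynomial at the real coordinates of a complex point. -/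
def evf {𝕜 : Type*} [RCLike 𝕜] (P : MvPolynomial (Fin 2) 𝕜) (w : ℂ) : 𝕜 :=
  MvPolynomial.eval ![(w.re : 𝕜), (w.im : 𝕜)] P

lemma evf_hasFDerivAt {𝕜 : Type*} [RCLike 𝕜] (P : MvPolynomial (Fin 2) 𝕜) (z : ℂ) :
    HasFDerivAt (𝕜 := ℝ) (evf P)
      (Complex.reCLM.smulRight (evf (MvPolynomial.pderiv 0 P) z) +
        Complex.imCLM.smulRight (evf (MvPolynomial.pderiv 1 P) z)) z := by
  induction P using MvPolynomial.induction_on with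
  | C a =>
    have : evf (MvPolynomial.C a : MvPolynomial (Fin 2) 𝕜) = fun _ => a := by
      funext w; simp [evf]
    rw [this]
    convert hasFDerivAt_const (𝕜 := ℝ) a z using 1
    ext <;> simp [evf]
  | add P Q hP hQ =>
    have : evf (P + Q) = fun w => evf P w + evf Q w := by
      funext w; simp [evf]
    rw [this]
    refine (hP.add hQ).congr_fderiv ?_
    ext x
    simp [evf, RCLike.real_smul_eq_coe_mul]; ring
  | mul_X P i hP =>
    have key : ∀ i : Fin 2, HasFDerivAt (𝕜 := ℝ) (evf (MvPolynomial.X i : MvPolynomial (Fin 2) 𝕜))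
      (Complex.reCLM.smulRight (evf (MvPolynomial.pderiv 0 (MvPolynomial.X i : MvPolynomial (Fin 2) 𝕜)) z) +
        Complex.imCLM.smulRight (evf (MvPolynomial.pderiv 1 (MvPolynomial.X i : MvPolynomial (Fin 2) 𝕜)) z)) z := by
      intro i
      fin_cases i
      · have : evf (MvPolynomial.X 0 : MvPolynomial (Fin 2) 𝕜) = fun w => (RCLike.ofRealCLM.comp Complex.reCLM) w := by
          funext w; simp [evf]
        simp only [Fin.zero_eta, this]
        convert (RCLike.ofRealCLM.comp Complex.reCLM : ℂ →L[ℝ] 𝕜).hasFDerivAt (x := z) using 1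
        ext <;> simp [evf, RCLike.real_smul_eq_coe_mul]
      · have : evf (MvPolynomial.X 1 : MvPolynomial (Fin 2) 𝕜) = fun w => (RCLike.ofRealCLM.comp Complex.imCLM) w := by
          funext w; simp [evf]
        simp only [Fin.mk_one, this]
        convert (RCLike.ofRealCLM.comp Complex.imCLM : ℂ →L[ℝ] 𝕜).hasFDerivAt (x := z) using 1
        ext <;> simp [evf, RCLike.real_smul_eq_coe_mul]
    have : evf (P * MvPolynomial.X i) = fun w => evf P w * evf (MvPolynomial.X i) w := by
      funext w; simp [evf]
    rw [this]
    refine (hP.mul (key i)).congr_fderiv ?_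
    have h1 : ∀ A B : MvPolynomial (Fin 2) 𝕜, evf (A + B) z = evf A z + evf B z := by
      intros; simp [evf]
    have h2 : ∀ A B : MvPolynomial (Fin 2) 𝕜, evf (A * B) z = evf A z * evf B z := by
      intros; simp [evf]
    ext x
    simp only [MvPolynomial.pderiv_mul, h1, h2]
    simp [RCLike.real_smul_eq_coe_mul, -MvPolynomial.pderiv_X]; ring

lemma evf_d1 {𝕜 : Type*} [RCLike 𝕜] (P : MvPolynomial (Fin 2) 𝕜) (z : ℂ) :
    fderiv ℝ (evf P) z 1 = evf (MvPolynomial.pderiv 0 P) z := by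
  rw [(evf_hasFDerivAt P z).fderiv]; simp

lemma evf_d2 {𝕜 : Type*} [RCLike 𝕜] (P : MvPolynomial (Fin 2) 𝕜) (z : ℂ) :
    fderiv ℝ (evf P) z Complex.I = evf (MvPolynomial.pderiv 1 P) z := by
  rw [(evf_hasFDerivAt P z).fderiv]; simp

abbrev CP := MvPolynomial (Fin 2) ℂ

def DD (P : CP) : CP := MvPolynomial.C (1/2) * (MvPolynomial.pderiv 0 P - MvPolynomial.C I * MvPolynomial.pderiv 1 P)
def EE (P : CP) : CP := MvPolynomial.C (1/2) * (MvPolynomial.pderiv 0 P + MvPolynomial.C I * MvPolynomial.pderiv 1 P)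

lemma Wz_evf (P : CP) : Wz (evf P) = evf (DD P) := by
  funext z
  simp only [Wz, pd₁, pd₂, evf_d1, evf_d2]
  simp [evf, DD]

lemma Wzb_evf (P : CP) : Wzb (evf P) = evf (EE P) := by
  funext z
  simp only [Wzb, pd₁, pd₂, evf_d1, evf_d2]
  simp [evf, EE]

lemma pderiv_comm' (P : CP) : MvPolynomial.pderiv 0 (MvPolynomial.pderiv 1 P) = MvPolynomial.pderiv 1 (MvPolynomial.pderiv 0 P) := by
  ext m
  simp only [MvPolynomial.coeff_pderiv]
  rw [add_right_comm]
  simp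
  ring

lemma DE_comm (P : CP) : DD (EE P) = EE (DD P) := by
  simp only [DD, EE, MvPolynomial.pderiv_C_mul, map_add, map_sub, pderiv_comm']
  ring

lemma iter_evf (P : CP) (j k : ℕ) : Wz^[j] (Wzb^[k] (evf P)) = evf (DD^[j] (EE^[k] P)) := by
  have h1 : Wzb^[k] (evf P) = evf (EE^[k] P) := by
    induction k with
    | zero => rfl
    | succ k ih => rw [Function.iterate_succ_apply', ih, Wzb_evf, Function.iterate_succ_apply']
  rw [h1]
  induction j with
  | zero => rfl
  | succ k ih => rw [Function.iterate_succ_apply', ih, Wz_evf, Function.iterate_succ_apply']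

lemma iter_shift (P : CP) (j k : ℕ) : DD^[j] (EE^[k] (DD P)) = DD^[j+1] (EE^[k] P) := by
  have h1 : EE^[k] (DD P) = DD (EE^[k] P) := by
    induction k with
    | zero => rfl
    | succ k ih => rw [Function.iterate_succ_apply', ih, ← DE_comm, Function.iterate_succ_apply']
  rw [h1, Function.iterate_succ_apply]

/-- All coefficients of degree at least `n` vanish. -/
def DegLt (n : ℕ) (P : CP) : Prop := ∀ m : Fin 2 →₀ ℕ, n ≤ m 0 + m 1 → P.coeff m = 0

lemma DegLt.zero {P : CP} (h : DegLt 0 P) : P = 0 := by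
  ext m; simpa using h m (Nat.zero_le _)

lemma DegLt.pd {n : ℕ} {P : CP} (h : DegLt (n+1) P) (i : Fin 2) : DegLt n (MvPolynomial.pderiv i P) := by
  intro m hm
  rw [MvPolynomial.coeff_pderiv, h, zero_mul]
  fin_cases i <;> simp <;> omega

lemma DegLt.D {n : ℕ} {P : CP} (h : DegLt (n+1) P) : DegLt n (DD P) := by
  intro m hm
  simp [DD, MvPolynomial.coeff_C_mul, h.pd 0 m hm, h.pd 1 m hm]

lemma DegLt.E {n : ℕ} {P : CP} (h : DegLt (n+1) P) : DegLt n (EE P) := by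
  intro m hm
  simp [EE, MvPolynomial.coeff_C_mul, h.pd 0 m hm, h.pd 1 m hm]

lemma DD_zero : DD 0 = 0 := by simp [DD]
lemma EE_zero : EE 0 = 0 := by simp [EE]

lemma DegLt.iterD {n : ℕ} {P : CP} (h : DegLt n P) (j : ℕ) : DegLt (n - j) (DD^[j] P) := by
  induction j with
  | zero => simpa using h
  | succ j ih =>
    rw [Function.iterate_succ_apply']
    rcases Nat.eq_zero_or_pos (n - j) with h0 | h0
    · rw [h0] at ih
      rw [ih.zero, DD_zero]; intro m _; simp
    · obtain ⟨l, hl⟩ : ∃ l, n - j = l + 1 := ⟨n - j - 1, by omega⟩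
      rw [hl] at ih
      rw [show n - (j+1) = l by omega]
      exact ih.D

lemma DegLt.iterE {n : ℕ} {P : CP} (h : DegLt n P) (j : ℕ) : DegLt (n - j) (EE^[j] P) := by
  induction j with
  | zero => simpa using h
  | succ j ih =>
    rw [Function.iterate_succ_apply']
    rcases Nat.eq_zero_or_pos (n - j) with h0 | h0
    · rw [h0] at ih
      rw [ih.zero, EE_zero]; intro m _; simp
    · obtain ⟨l, hl⟩ : ∃ l, n - j = l + 1 := ⟨n - j - 1, by omega⟩
      rw [hl] at ih
      rw [show n - (j+1) = l by omega]
      exact ih.E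

lemma exists_DegLt (P : CP) : ∃ n, DegLt n P := by
  refine ⟨P.support.sup (fun m => m 0 + m 1) + 1, fun m hm => ?_⟩
  by_contra h
  have := Finset.le_sup (f := fun m : Fin 2 →₀ ℕ => m 0 + m 1) (MvPolynomial.mem_support_iff.2 h)
  omega

lemma taylor_zero (z : ℂ) (n : ℕ) : ∀ P : CP, DegLt n P →
    (∀ j k, evf (DD^[j] (EE^[k] P)) z = 0) → ∀ w, evf P w = 0 := by
  induction n with
  | zero => intro P hP _ w; rw [hP.zero]; simp [evf]
  | succ n ih =>
    intro P hP h w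
    have hD := ih _ hP.D (fun j k => by rw [iter_shift]; exact h _ _)
    have hE := ih _ hP.E (fun j k => by
      rw [← Function.iterate_succ_apply]; exact h _ _)
    have h0 : ∀ u, evf (MvPolynomial.pderiv 0 P) u = 0 := fun u => by
      have a := hD u; have b := hE u
      simp only [evf, DD, EE, map_mul, map_add, map_sub, MvPolynomial.eval_C] at a b ⊢
      linear_combination a + b
    have h1 : ∀ u, evf (MvPolynomial.pderiv 1 P) u = 0 := fun u => by
      have a := hD u; have b := hE u
      simp only [evf, DD, EE, map_mul, map_add, map_sub, MvPolynomial.eval_C] at a b ⊢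
      linear_combination (-I) * (b - a) + (MvPolynomial.eval ![((u.re : ℝ) : ℂ), (u.im : ℂ)] (MvPolynomial.pderiv 1 P)) * I_sq
    have hc := is_const_of_fderiv_eq_zero (𝕜 := ℝ) (f := evf P)
      (fun x => (evf_hasFDerivAt P x).differentiableAt)
      (fun x => by rw [(evf_hasFDerivAt P x).fderiv, h0, h1]; simp) w z
    rw [hc]; exact h 0 0

lemma lap_evf (P : MvPolynomial (Fin 2) ℝ) (z : ℂ) :
    ((lapR (evf P) z : ℝ) : ℂ) = 4 * evf (DD (EE (MvPolynomial.map Complex.ofRealHom P))) z := by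
  have e1 : pdR₁ (evf P) = evf (MvPolynomial.pderiv 0 P) := funext fun w => evf_d1 P w
  have e2 : pdR₂ (evf P) = evf (MvPolynomial.pderiv 1 P) := funext fun w => evf_d2 P w
  have e3 : ∀ Q : MvPolynomial (Fin 2) ℝ, evf (MvPolynomial.map Complex.ofRealHom Q) z = ((evf Q z : ℝ) : ℂ) := by
    intro Q
    simp only [evf, MvPolynomial.eval_map]
    rw [← Complex.ofRealHom_eq_coe, MvPolynomial.eval, MvPolynomial.coe_eval₂Hom, MvPolynomial.hom_eval₂]
    congr 1
    funext i
    fin_cases i <;> simp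
  have ea : ∀ A B : CP, evf (A + B) z = evf A z + evf B z := by intros; simp [evf]
  have es : ∀ A B : CP, evf (A - B) z = evf A z - evf B z := by intros; simp [evf]
  have em : ∀ A B : CP, evf (A * B) z = evf A z * evf B z := by intros; simp [evf]
  have ec : ∀ a : ℂ, evf (MvPolynomial.C a : CP) z = a := by intros; simp [evf]
  have hl : lapR (evf P) z = evf (MvPolynomial.pderiv 0 (MvPolynomial.pderiv 0 P)) z +
      evf (MvPolynomial.pderiv 1 (MvPolynomial.pderiv 1 P)) z := by
    show fderiv ℝ (pdR₁ (evf P)) z 1 + fderiv ℝ (pdR₂ (evf P)) z I = _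
    rw [e1, e2, evf_d1, evf_d2]
  rw [hl, Complex.ofReal_add, ← e3, ← e3]
  simp only [DD, EE, MvPolynomial.pderiv_C_mul, map_add, pderiv_comm', ea, es, em, ec,
    ← MvPolynomial.pderiv_map]
  linear_combination (evf (MvPolynomial.pderiv 1 (MvPolynomial.pderiv 1 (MvPolynomial.map Complex.ofRealHom P))) z) * I_sq

/-- The two qualitative facts about the coefficients. -/
lemma Ajk_facts (p : ℂ → ℝ) (hpoly : IsRealPoly p) (hnonharm : ∃ z : ℂ, lapR p z ≠ 0) :
    ∃ N : ℕ, (∀ z j k, N ≤ j ∨ N ≤ k → Ajk p j k z = 0) ∧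
      ∀ z, ∃ j k, 1 ≤ j ∧ 1 ≤ k ∧ Ajk p j k z ≠ 0 := by
  obtain ⟨P, hP⟩ := hpoly
  have hp : p = evf P := funext fun z => by rw [hP]; rfl
  set Q : CP := MvPolynomial.map Complex.ofRealHom P with hQ
  have hpc : (fun w => (p w : ℂ)) = evf Q := by
    funext w
    rw [hp]
    simp only [evf, hQ, MvPolynomial.eval_map]
    rw [← Complex.ofRealHom_eq_coe, MvPolynomial.eval, MvPolynomial.coe_eval₂Hom, MvPolynomial.hom_eval₂]
    congr 1
    funext i
    fin_cases i <;> simp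
  have hA : ∀ j k z, Ajk p j k z = (1 / (Nat.factorial j * Nat.factorial k) : ℂ) * evf (DD^[j] (EE^[k] Q)) z := by
    intro j k z
    rw [Ajk, hpc, iter_evf]
  obtain ⟨N, hN⟩ := exists_DegLt Q
  refine ⟨N, fun z j k hjk => ?_, fun z => ?_⟩
  · have h1 := (hN.iterE k).iterD j
    rw [show N - k - j = 0 by omega] at h1
    rw [hA, h1.zero]; simp [evf]
  · by_contra! hcon
    obtain ⟨w, hw⟩ := hnonharm
    apply hw
    have := lap_evf P w
    rw [← hp, ← hQ] at this
    obtain ⟨n, hn⟩ := exists_DegLt (DD (EE Q))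
    rw [taylor_zero z n _ hn, mul_zero] at this
    · exact_mod_cast this
    intro j k
    rw [iter_shift, ← Function.iterate_succ_apply EE]
    have h2 := hcon (j+1) (k+1) (by omega) (by omega)
    rw [hA] at h2
    refine (mul_eq_zero.1 h2).resolve_left ?_
    have := Nat.factorial_ne_zero (j+1)
    have := Nat.factorial_ne_zero (k+1)
    simp only [one_div]
    exact inv_ne_zero (mul_ne_zero (by exact_mod_cast ‹(j+1).factorial ≠ 0›) (by exact_mod_cast ‹(k+1).factorial ≠ 0›))

lemma root_le_iff {a d r : ℝ} {n : ℕ} (hn : n ≠ 0) (ha : 0 < a) (hd : 0 ≤ d) (hr : 0 ≤ r) :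
    (d / a) ^ ((n : ℝ))⁻¹ ≤ r ↔ d ≤ a * r ^ n := by
  rw [Real.rpow_inv_le_iff_of_pos (by positivity) hr (by positivity), Real.rpow_natCast, div_le_iff₀ ha, mul_comm]

lemma le_root_iff {a d r : ℝ} {n : ℕ} (hn : n ≠ 0) (ha : 0 < a) (hd : 0 ≤ d) (hr : 0 ≤ r) :
    r ≤ (d / a) ^ ((n : ℝ))⁻¹ ↔ a * r ^ n ≤ d := by
  rw [Real.le_rpow_inv_iff_of_pos hr (by positivity) (by positivity), Real.rpow_natCast, le_div_iff₀ ha, mul_comm]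

/-- `μ_p(z,·)` is an approximate inverse of `Λ(z,·)`. -/
theorem statement10 (p : ℂ → ℝ) (hpoly : IsRealPoly p)
    (hsub : ∀ z : ℂ, 0 ≤ lapR p z) (hnonharm : ∃ z : ℂ, lapR p z ≠ 0) :
    ∃ c₁ : ℝ, 0 < c₁ ∧ ∃ c₂ : ℝ, 0 < c₂ ∧ ∀ z : ℂ, ∀ δ : ℝ, 0 < δ →
      c₁ * δ ≤ mu p z (Lam p z δ) ∧ mu p z (Lam p z δ) ≤ c₂ * δ ∧
      c₁ * δ ≤ Lam p z (mu p z δ) ∧ Lam p z (mu p z δ) ≤ c₂ * δ := by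
  obtain ⟨N, hN, hex⟩ := Ajk_facts p hpoly hnonharm
  refine ⟨1, one_pos, (N : ℝ) * N + 1, by positivity, fun z δ hδ => ?_⟩
  set c : ℝ := (N : ℝ) * N + 1 with hc
  have hc1 : 1 ≤ c := by rw [hc]; nlinarith [sq_nonneg (N : ℝ)]
  have hLam : ∀ r, Lam p z r = ∑ x ∈ Finset.range N ×ˢ Finset.range N,
      ‖Ajk p (x.1 + 1) (x.2 + 1) z‖ * r ^ (x.1 + x.2 + 2) := by
    intro r
    rw [Finset.sum_product, Lam, tsum_eq_sum (s := Finset.range N)]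
    · refine Finset.sum_congr rfl fun j _ => ?_
      rw [tsum_eq_sum (s := Finset.range N)]
      intro k hk
      rw [hN z _ _ (Or.inr (by simp at hk; omega))]; simp
    · intro j hj
      have : ∀ k, ‖Ajk p (j + 1) (k + 1) z‖ * r ^ (j + k + 2) = 0 := fun k => by
        rw [hN z _ _ (Or.inl (by simp at hj; omega))]; simp
      simp [this]
  have hterm : ∀ r, 0 ≤ r → ∀ j k, 1 ≤ j → 1 ≤ k → ‖Ajk p j k z‖ * r ^ (j + k) ≤ Lam p z r := by
    intro r hr j k hj hk
    by_cases h : N ≤ j ∨ N ≤ k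
    · rw [hN z j k h, hLam]; simp only [norm_zero, zero_mul]
      exact Finset.sum_nonneg fun _ _ => by positivity
    · rw [hLam]
      have := Finset.single_le_sum (f := fun x : ℕ × ℕ => ‖Ajk p (x.1 + 1) (x.2 + 1) z‖ * r ^ (x.1 + x.2 + 2))
        (s := Finset.range N ×ˢ Finset.range N) (fun _ _ => by positivity)
        (a := (j-1, k-1)) (by simp; omega)
      simp only at this
      rwa [show j - 1 + 1 = j by omega, show k - 1 + 1 = k by omega,
        show j - 1 + (k - 1) + 2 = j + k by omega] at this
  have hupper : ∀ r d, 0 ≤ d → (∀ j k, 1 ≤ j → 1 ≤ k → Ajk p j k z ≠ 0 → ‖Ajk p j k z‖ * r ^ (j + k) ≤ d) →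
      Lam p z r ≤ (N : ℝ) * N * d := by
    intro r d hd h
    rw [hLam]
    refine (Finset.sum_le_card_nsmul _ _ d fun x _ => ?_).trans (le_of_eq (by simp))
    by_cases h0 : Ajk p (x.1 + 1) (x.2 + 1) z = 0
    · rw [h0]; simpa using hd
    · have := h (x.1 + 1) (x.2 + 1) (by omega) (by omega) h0
      rwa [show x.1 + 1 + (x.2 + 1) = x.1 + x.2 + 2 by omega] at this
  have hnorm : ∀ d : ℝ, 0 ≤ d → ∀ j k, ‖(d : ℂ) / Ajk p j k z‖ = d / ‖Ajk p j k z‖ := by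
    intro d hd j k
    rw [norm_div, Complex.norm_real, Real.norm_of_nonneg hd]
  have hmem : ∀ d, 0 ≤ d → ∃ j k, 1 ≤ j ∧ 1 ≤ k ∧ Ajk p j k z ≠ 0 ∧
      mu p z d = (d / ‖Ajk p j k z‖) ^ (((j + k : ℕ) : ℝ))⁻¹ := by
    intro d hd
    have hne : { r : ℝ | ∃ j k : ℕ, 1 ≤ j ∧ 1 ≤ k ∧ Ajk p j k z ≠ 0 ∧
        r = ‖(d : ℂ) / Ajk p j k z‖ ^ (((j + k : ℕ) : ℝ))⁻¹ }.Nonempty := by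
      obtain ⟨j, k, hj, hk, h⟩ := hex z
      exact ⟨_, j, k, hj, hk, h, rfl⟩
    have hfin : { r : ℝ | ∃ j k : ℕ, 1 ≤ j ∧ 1 ≤ k ∧ Ajk p j k z ≠ 0 ∧
        r = ‖(d : ℂ) / Ajk p j k z‖ ^ (((j + k : ℕ) : ℝ))⁻¹ }.Finite := by
      refine ((Finset.range N ×ˢ Finset.range N).finite_toSet.image
        (fun x : ℕ × ℕ => ‖(d : ℂ) / Ajk p x.1 x.2 z‖ ^ (((x.1 + x.2 : ℕ) : ℝ))⁻¹)).subset ?_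
      rintro r ⟨j, k, hj, hk, h, rfl⟩
      refine ⟨(j, k), ?_, rfl⟩
      by_contra hcon
      apply h
      apply hN
      simp at hcon
      omega
    obtain ⟨j, k, hj, hk, h, e⟩ := hne.csInf_mem hfin
    refine ⟨j, k, hj, hk, h, ?_⟩
    rw [mu, e, hnorm d hd]
  have hmu_le : ∀ d, 0 ≤ d → ∀ j k, 1 ≤ j → 1 ≤ k → Ajk p j k z ≠ 0 →
      mu p z d ≤ (d / ‖Ajk p j k z‖) ^ (((j + k : ℕ) : ℝ))⁻¹ := by
    intro d hd j k hj hk h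
    rw [← hnorm d hd]
    refine csInf_le ⟨0, ?_⟩ ⟨j, k, hj, hk, h, rfl⟩
    rintro r ⟨j, k, _, _, _, rfl⟩
    positivity
  have hL0 : ∀ r, 0 ≤ r → 0 ≤ Lam p z r := fun r hr => by
    rw [hLam]; exact Finset.sum_nonneg fun _ _ => by positivity
  have hmu0 : ∀ d, 0 ≤ d → 0 ≤ mu p z d := fun d hd => by
    obtain ⟨j, k, -, -, -, e⟩ := hmem d hd
    rw [e]; positivity
  refine ⟨?_, ?_, ?_, ?_⟩
  · obtain ⟨j, k, hj, hk, h, e⟩ := hmem _ (hL0 δ hδ.le)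
    rw [e, one_mul, le_root_iff (by omega) (norm_pos_iff.2 h) (hL0 δ hδ.le) hδ.le]
    exact hterm δ hδ.le j k hj hk
  · by_contra! hlt
    have hLpos : 0 < Lam p z δ := by
      obtain ⟨j, k, hj, hk, h⟩ := hex z
      exact lt_of_lt_of_le (mul_pos (norm_pos_iff.2 h) (pow_pos hδ _)) (hterm δ hδ.le j k hj hk)
    have hb : ∀ j k, 1 ≤ j → 1 ≤ k → Ajk p j k z ≠ 0 →
        ‖Ajk p j k z‖ * δ ^ (j + k) ≤ Lam p z δ / c := by
      intro j k hj hk h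
      have h1 := hlt.le.trans (hmu_le _ hLpos.le j k hj hk h)
      rw [le_root_iff (by omega) (norm_pos_iff.2 h) hLpos.le (by positivity)] at h1
      rw [le_div_iff₀ (by positivity)]
      refine le_trans ?_ h1
      rw [mul_pow, mul_assoc, mul_comm (δ ^ (j+k))]
      gcongr
      exact le_self_pow₀ hc1 (by omega)
    have h2 := hupper δ _ (by positivity) hb
    rw [← mul_div_assoc, le_div_iff₀ (by positivity), hc] at h2
    linarith
  · obtain ⟨j, k, hj, hk, h, e⟩ := hmem δ hδ.le
    rw [one_mul]
    refine le_trans ?_ (hterm _ (hmu0 δ hδ.le) j k hj hk)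
    rw [← root_le_iff (by omega) (norm_pos_iff.2 h) hδ.le (hmu0 δ hδ.le), e]
  · refine (hupper (mu p z δ) δ hδ.le fun j k hj hk h => ?_).trans ?_
    · rw [← le_root_iff (by omega) (norm_pos_iff.2 h) hδ.le (hmu0 δ hδ.le)]
      exact hmu_le δ hδ.le j k hj hk h
    · rw [hc]; nlinarith

end
end

section
/- Fix z₀ ∈ ℂ and s₀ > 0, and let u = u(s,z) be a complex-valued C² function on a neighborhood of the closed cone {(s,z) : 0 ≤ s ≤ s₀, |z − z₀| ≤ s₀ − s} satisfying the wave equation ∂²u/∂s² + □̃_{τp} u = 0 there. Define the energy e[u](s) = ∫_{D(z₀, s₀−s)} ( |∂u/∂s (s,z)|² + |Z̄_{τp} u(s,·)(z)|² ) dA(z). Then e[u](s) ≤ e[u](0) for all 0 ≤ s ≤ s₀. -/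
open MeasureTheory Complex

noncomputable section

/-- Time derivative `∂u/∂s` for `u : ℝ × ℂ → ℂ`. -/
def timeDeriv (u : ℝ × ℂ → ℂ) (q : ℝ × ℂ) : ℂ := fderiv ℝ u q (1, 0)


lemma slice_fderiv {Y : Type*} [NormedAddCommGroup Y] [NormedSpace ℝ Y] (G : ℝ × ℂ → Y) (s : ℝ) (z : ℂ) (h : DifferentiableAt ℝ G (s, z)) :
    HasFDerivAt (fun w => G (s, w)) ((fderiv ℝ G (s, z)).comp (ContinuousLinearMap.inr ℝ ℝ ℂ)) z := by
  have h2 : HasFDerivAt (fun w : ℂ => (s, w)) (ContinuousLinearMap.inr ℝ ℝ ℂ) z :=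
    hasFDerivAt_prodMk_right s z
  exact HasFDerivAt.comp z h.hasFDerivAt h2

lemma time_slice (G : ℝ × ℂ → ℝ) (s : ℝ) (z : ℂ) (h : DifferentiableAt ℝ G (s, z)) :
    HasDerivAt (fun t => G (t, z)) (fderiv ℝ G (s, z) (1, 0)) s := by
  have h2 : HasFDerivAt (fun t : ℝ => (t, z)) (ContinuousLinearMap.inl ℝ ℝ ℂ) s :=
    hasFDerivAt_prodMk_left s z
  have := (HasFDerivAt.comp s h.hasFDerivAt h2).hasDerivAt
  have e : ((fderiv ℝ G (s, z)).comp (ContinuousLinearMap.inl ℝ ℝ ℂ)) 1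
      = fderiv ℝ G (s, z) (1, 0) := by simp
  rw [e] at this
  exact this

lemma supp_zero (Φ : ℝ × ℂ → ℝ) (z₀ : ℂ) (s₀ : ℝ)
    (h0 : ∀ s z, |s₀ - s| < ‖z - z₀‖ → Φ (s, z) = 0) (s : ℝ) (z : ℂ)
    (h : |s₀ - s| < ‖z - z₀‖) : fderiv ℝ Φ (s, z) = 0 := by
  have : Φ =ᶠ[nhds (s, z)] fun _ => 0 := by
    have hop : IsOpen {q : ℝ × ℂ | |s₀ - q.1| < ‖q.2 - z₀‖} :=
      isOpen_lt (by fun_prop) (by fun_prop)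
    filter_upwards [hop.mem_nhds h] with q hq
    exact h0 q.1 q.2 hq
  rw [this.fderiv_eq]; simp

lemma integrable_of_supp (f : ℂ → ℝ) (hf : Continuous f) (z₀ : ℂ) (R : ℝ)
    (h : ∀ z, R < ‖z - z₀‖ → f z = 0) : Integrable f := by
  apply hf.integrable_of_hasCompactSupport
  apply HasCompactSupport.intro (isCompact_closedBall z₀ R)
  intro z hz
  apply h
  simpa [dist_eq_norm] using hz

lemma param_deriv (Φ : ℝ × ℂ → ℝ) (hΦ : ContDiff ℝ 1 Φ) (z₀ : ℂ) (s₀ : ℝ)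
    (h0 : ∀ s z, |s₀ - s| < ‖z - z₀‖ → Φ (s, z) = 0) (s : ℝ) :
    HasDerivAt (fun t => ∫ z, Φ (t, z)) (∫ z, fderiv ℝ Φ (s, z) (1, 0)) s := by
  have hc : Continuous Φ := hΦ.continuous
  have hd : Differentiable ℝ Φ := hΦ.differentiable (by norm_num)
  have hcf : Continuous (fun q : ℝ × ℂ => fderiv ℝ Φ q (1, 0)) := by
    have := hΦ.continuous_fderiv (by norm_num)
    fun_prop
  let R := |s₀ - s| + 1
  obtain ⟨C, hC⟩ := ((isCompact_closedBall s 1).prod (isCompact_closedBall z₀ R)).exists_bound_of_continuousOn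
    hcf.continuousOn
  have key := hasDerivAt_integral_of_dominated_loc_of_deriv_le (μ := volume) (𝕜 := ℝ)
    (F := fun t z => Φ (t, z)) (F' := fun t z => fderiv ℝ Φ (t, z) (1, 0)) (x₀ := s)
    (s := Metric.closedBall s 1) (bound := (Metric.closedBall z₀ R).indicator (fun _ => C))
    (Metric.closedBall_mem_nhds s one_pos)
    (Filter.Eventually.of_forall fun t => by
      exact (hc.comp (by fun_prop : Continuous fun z : ℂ => (t, z))).aestronglyMeasurable)
    (integrable_of_supp _ (hc.comp (by fun_prop : Continuous fun z : ℂ => (s, z))) z₀ |s₀ - s|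
      (fun z hz => h0 s z hz))
    (hcf.comp (by fun_prop : Continuous fun z : ℂ => (s, z))).aestronglyMeasurable
    (Filter.Eventually.of_forall fun z t ht => by
      by_cases hz : z ∈ Metric.closedBall z₀ R
      · rw [Set.indicator_of_mem hz]
        exact hC (t, z) ⟨ht, hz⟩
      · rw [Set.indicator_of_notMem hz, supp_zero Φ z₀ s₀ h0]
        · simp
        · have h1 : R < ‖z - z₀‖ := by simpa [dist_eq_norm] using hz
          have h2 : |t - s| ≤ 1 := by simpa [Real.dist_eq] using ht
          have h3 : |s₀ - t| ≤ |s₀ - s| + |t - s| := by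
            rw [abs_sub_comm t s]; exact abs_sub_le _ _ _
          simp only [R] at h1
          linarith)
    ((integrable_indicator_iff Metric.isClosed_closedBall.measurableSet).2
      (integrableOn_const (isCompact_closedBall z₀ R).measure_lt_top.ne (by simp)))
    (Filter.Eventually.of_forall fun z t ht => time_slice Φ t z (hd _))
  exact key.2

lemma ibp (φ G : ℝ × ℂ → ℝ) (hφ : ContDiff ℝ 1 φ) (hG : ContDiff ℝ 1 G) (z₀ : ℂ) (s₀ : ℝ)
    (h0 : ∀ s z, |s₀ - s| < ‖z - z₀‖ → φ (s, z) = 0) (s : ℝ) (h : ℂ) :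
    Integrable (fun z => φ (s, z) * fderiv ℝ G (s, z) (0, h)) ∧
    Integrable (fun z => fderiv ℝ φ (s, z) (0, h) * G (s, z)) ∧
    ∫ z, φ (s, z) * fderiv ℝ G (s, z) (0, h) = - ∫ z, fderiv ℝ φ (s, z) (0, h) * G (s, z) := by
  have hsl : Continuous fun z : ℂ => (s, z) := by fun_prop
  have c1 : Continuous fun z => φ (s, z) := hφ.continuous.comp hsl
  have c2 : Continuous fun z => G (s, z) := hG.continuous.comp hsl
  have c3 : Continuous fun z => fderiv ℝ φ (s, z) (0, h) := by
    have := (hφ.continuous_fderiv (by norm_num)).comp hsl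
    exact this.clm_apply continuous_const
  have c4 : Continuous fun z => fderiv ℝ G (s, z) (0, h) := by
    have := (hG.continuous_fderiv (by norm_num)).comp hsl
    exact this.clm_apply continuous_const
  have d1 := hφ.differentiable (by norm_num)
  have d2 := hG.differentiable (by norm_num)
  have i1 : Integrable (fun z => φ (s, z) * fderiv ℝ G (s, z) (0, h)) :=
    integrable_of_supp _ (c1.mul c4) z₀ |s₀ - s| (fun z hz => by simp [h0 s z hz])
  have i2 : Integrable (fun z => fderiv ℝ φ (s, z) (0, h) * G (s, z)) :=
    integrable_of_supp _ (c3.mul c2) z₀ |s₀ - s| (fun z hz => by simp [supp_zero φ z₀ s₀ h0 s z hz])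
  have i3 : Integrable (fun z => φ (s, z) * G (s, z)) :=
    integrable_of_supp _ (c1.mul c2) z₀ |s₀ - s| (fun z hz => by simp [h0 s z hz])
  refine ⟨i1, i2, ?_⟩
  have e1 : ∀ z, fderiv ℝ (fun w => φ (s, w)) z h = fderiv ℝ φ (s, z) (0, h) := fun z => by
    rw [(slice_fderiv φ s z (d1 _)).fderiv]; simp
  have e2 : ∀ z, fderiv ℝ (fun w => G (s, w)) z h = fderiv ℝ G (s, z) (0, h) := fun z => by
    rw [(slice_fderiv G s z (d2 _)).fderiv]; simp
  have := integral_mul_fderiv_eq_neg_fderiv_mul_of_integrable (μ := (volume : Measure ℂ))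
    (f := fun w => φ (s, w)) (g := fun w => G (s, w)) (v := h)
    (by simpa only [e1] using i2) (by simpa only [e2] using i1) i3
    (fun z _ => (slice_fderiv φ s z (d1 _)).differentiableAt)
    (fun z _ => (slice_fderiv G s z (d2 _)).differentiableAt)
  simpa only [e1, e2] using this

/-- Space-time cone function. -/
def coneFun (z₀ : ℂ) (s₀ : ℝ) (q : ℝ × ℂ) : ℝ :=
  (s₀ - q.1) ^ 2 - ((q.2.re - z₀.re) ^ 2 + (q.2.im - z₀.im) ^ 2)

lemma coneFun_eq (z₀ : ℂ) (s₀ s : ℝ) (z : ℂ) :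
    coneFun z₀ s₀ (s, z) = (s₀ - s) ^ 2 - ‖z - z₀‖ ^ 2 := by
  rw [Complex.sq_norm, Complex.normSq_apply]; simp [coneFun]; ring

lemma coneFun_deriv (z₀ : ℂ) (s₀ : ℝ) (q k : ℝ × ℂ) :
    fderiv ℝ (coneFun z₀ s₀) q k = -2 * (s₀ - q.1) * k.1
      - 2 * ((q.2.re - z₀.re) * k.2.re + (q.2.im - z₀.im) * k.2.im) := by
  have h1 : HasFDerivAt (fun q : ℝ × ℂ => q.1) (ContinuousLinearMap.fst ℝ ℝ ℂ) q := hasFDerivAt_fst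
  have h2 : HasFDerivAt (fun q : ℝ × ℂ => q.2.re)
    (Complex.reCLM.comp (ContinuousLinearMap.snd ℝ ℝ ℂ)) q :=
      (Complex.reCLM.comp (ContinuousLinearMap.snd ℝ ℝ ℂ)).hasFDerivAt
  have h3 : HasFDerivAt (fun q : ℝ × ℂ => q.2.im)
    (Complex.imCLM.comp (ContinuousLinearMap.snd ℝ ℝ ℂ)) q :=
      (Complex.imCLM.comp (ContinuousLinearMap.snd ℝ ℝ ℂ)).hasFDerivAt
  have := (((h1.const_sub s₀).pow 2).sub (((h2.sub_const z₀.re).pow 2).add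
    ((h3.sub_const z₀.im).pow 2)))
  have e : fderiv ℝ (coneFun z₀ s₀) q = _ := this.fderiv
  rw [e]
  simp
  ring

lemma coneFun_contDiff (z₀ : ℂ) (s₀ : ℝ) : ContDiff ℝ 1 (coneFun z₀ s₀) := by
  have h2 : ContDiff ℝ 1 (fun q : ℝ × ℂ => q.2.re) :=
      (Complex.reCLM.comp (ContinuousLinearMap.snd ℝ ℝ ℂ)).contDiff
  have h3 : ContDiff ℝ 1 (fun q : ℝ × ℂ => q.2.im) :=
      (Complex.imCLM.comp (ContinuousLinearMap.snd ℝ ℝ ℂ)).contDiff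
  unfold coneFun
  fun_prop

lemma mono_cut (E F₁ F₂ : ℝ × ℂ → ℝ) (hE : ContDiff ℝ 1 E) (hF₁ : ContDiff ℝ 1 F₁)
    (hF₂ : ContDiff ℝ 1 F₂) (z₀ : ℂ) (s₀ : ℝ)
    (hE0 : ∀ q, 0 ≤ E q)
    (hdiv : ∀ s z, 0 ≤ s → s ≤ s₀ → ‖z - z₀‖ ≤ s₀ - s →
      fderiv ℝ E (s, z) (1, 0) = fderiv ℝ F₁ (s, z) (0, 1) + fderiv ℝ F₂ (s, z) (0, I))
    (hF : ∀ s z, 0 ≤ s → s ≤ s₀ → ‖z - z₀‖ ≤ s₀ - s →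
      F₁ (s, z) ^ 2 + F₂ (s, z) ^ 2 ≤ E (s, z) ^ 2)
    (χ : ℝ → ℝ) (hχ : ContDiff ℝ 1 χ) (hm : Monotone χ) (hχ0 : ∀ t ≤ 0, χ t = 0)
    (s : ℝ) (hs : 0 ≤ s) (hss : s ≤ s₀) :
    ∫ z, χ (coneFun z₀ s₀ (s, z)) * E (s, z) ≤ ∫ z, χ (coneFun z₀ s₀ (0, z)) * E (0, z) := by
  set φ : ℝ × ℂ → ℝ := fun q => χ (coneFun z₀ s₀ q) with hφdef
  have hφ : ContDiff ℝ 1 φ := hχ.comp (coneFun_contDiff z₀ s₀)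
  have h0 : ∀ s z, |s₀ - s| < ‖z - z₀‖ → φ (s, z) = 0 := by
    intro s z h
    apply hχ0
    rw [coneFun_eq, ← sq_abs (s₀ - s)]
    have := abs_nonneg (s₀ - s)
    nlinarith
  have hφd : ∀ q k, fderiv ℝ φ q k = deriv χ (coneFun z₀ s₀ q) * fderiv ℝ (coneFun z₀ s₀) q k := by
    intro q k
    have a := (hχ.differentiable (by norm_num) (coneFun z₀ s₀ q)).hasDerivAt
    have b := ((coneFun_contDiff z₀ s₀).differentiable (by norm_num) q).hasFDerivAt
    have : fderiv ℝ φ q = _ := (a.comp_hasFDerivAt q b).fderiv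
    rw [this]; simp
  have dφ := hφ.differentiable (by norm_num)
  have dE := hE.differentiable (by norm_num)
  have hΦ : ContDiff ℝ 1 (fun q => φ q * E q) := hφ.mul hE
  have hD := param_deriv (fun q => φ q * E q) hΦ z₀ s₀ (fun s z h => by simp [h0 s z h])
  have hanti : AntitoneOn (fun t => ∫ z, φ (t, z) * E (t, z)) (Set.Icc 0 s₀) := by
    apply antitoneOn_of_deriv_nonpos (convex_Icc 0 s₀)
    · exact fun t _ => (hD t).continuousAt.continuousWithinAt
    · exact fun t _ => (hD t).differentiableAt.differentiableWithinAt
    intro t ht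
    rw [interior_Icc] at ht
    rw [(hD t).deriv]
    have e1 : ∀ z, fderiv ℝ (fun q => φ q * E q) (t, z) (1, 0)
        = (φ (t, z) * fderiv ℝ F₁ (t, z) (0, 1) + φ (t, z) * fderiv ℝ F₂ (t, z) (0, I))
          + E (t, z) * fderiv ℝ φ (t, z) (1, 0) := by
      intro z
      rw [fderiv_fun_mul (dφ _) (dE _)]
      simp only [add_apply, smul_apply, smul_eq_mul]
      by_cases hz : ‖z - z₀‖ ≤ s₀ - t
      · rw [hdiv t z ht.1.le ht.2.le hz]; ring
      · have : φ (t, z) = 0 := h0 t z (by rw [abs_of_pos (by linarith [ht.2])]; linarith)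
        simp [this]
    obtain ⟨a1, a2, a3⟩ := ibp φ F₁ hφ hF₁ z₀ s₀ h0 t 1
    obtain ⟨b1, b2, b3⟩ := ibp φ F₂ hφ hF₂ z₀ s₀ h0 t I
    have hsl : Continuous fun z : ℂ => (t, z) := by fun_prop
    have i3 : Integrable (fun z => E (t, z) * fderiv ℝ φ (t, z) (1, 0)) := by
      refine integrable_of_supp _ ?_ z₀ |s₀ - t|
        (fun z hz => by simp [supp_zero φ z₀ s₀ h0 t z hz])
      refine (hE.continuous.comp hsl).mul ?_
      exact ((hφ.continuous_fderiv (by norm_num)).comp hsl).clm_apply continuous_const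
    simp_rw [e1]
    rw [integral_add (by exact a1.add b1) i3, integral_add a1 b1, a3, b3, ← neg_add,
      ← integral_add a2 b2, ← integral_neg, ← integral_add (by exact (a2.add b2).neg) i3]
    apply integral_nonpos
    intro z
    simp only [Pi.zero_apply]
    by_cases hz : ‖z - z₀‖ ≤ s₀ - t
    · rw [hφd, hφd, hφd]
      simp only [coneFun_deriv]
      have hd : 0 ≤ deriv χ (coneFun z₀ s₀ (t, z)) := hm.deriv_nonneg
      set d := deriv χ (coneFun z₀ s₀ (t, z))
      have h1 := hF t z ht.1.le ht.2.le hz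
      have h2 := hE0 (t, z)
      have h3 : (z.re - z₀.re) ^ 2 + (z.im - z₀.im) ^ 2 ≤ (s₀ - t) ^ 2 := by
        have := coneFun_eq z₀ s₀ t z
        simp only [coneFun] at this
        have h4 : ‖z - z₀‖ ^ 2 ≤ (s₀ - t) ^ 2 := by gcongr
        linarith
      set a := z.re - z₀.re
      set b := z.im - z₀.im
      have h5 : 0 ≤ s₀ - t := by linarith [ht.2]
      have h6 : a * F₁ (t, z) + b * F₂ (t, z) ≤ (s₀ - t) * E (t, z) := by
        apply le_of_sq_le_sq _ (by positivity)
        calc (a * F₁ (t, z) + b * F₂ (t, z)) ^ 2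
            ≤ (a ^ 2 + b ^ 2) * (F₁ (t, z) ^ 2 + F₂ (t, z) ^ 2) := by
              nlinarith [sq_nonneg (a * F₂ (t, z) - b * F₁ (t, z))]
          _ ≤ (s₀ - t) ^ 2 * E (t, z) ^ 2 := by gcongr
          _ = _ := by ring
      have h7 := mul_nonneg hd (sub_nonneg.2 h6)
      simp
      nlinarith
    · have : fderiv ℝ φ (t, z) = 0 := supp_zero φ z₀ s₀ h0 t z
        (by rw [abs_of_pos (by linarith [ht.2])]; linarith)
      simp [this]
  exact hanti ⟨le_rfl, hs.trans hss⟩ ⟨hs, hss⟩ hs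

lemma energy_global (E F₁ F₂ : ℝ × ℂ → ℝ) (hE : ContDiff ℝ 1 E) (hF₁ : ContDiff ℝ 1 F₁)
    (hF₂ : ContDiff ℝ 1 F₂) (z₀ : ℂ) (s₀ : ℝ)
    (hE0 : ∀ q, 0 ≤ E q)
    (hdiv : ∀ s z, 0 ≤ s → s ≤ s₀ → ‖z - z₀‖ ≤ s₀ - s →
      fderiv ℝ E (s, z) (1, 0) = fderiv ℝ F₁ (s, z) (0, 1) + fderiv ℝ F₂ (s, z) (0, I))
    (hF : ∀ s z, 0 ≤ s → s ≤ s₀ → ‖z - z₀‖ ≤ s₀ - s →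
      F₁ (s, z) ^ 2 + F₂ (s, z) ^ 2 ≤ E (s, z) ^ 2)
    (s : ℝ) (hs : 0 ≤ s) (hss : s ≤ s₀) :
    ∫ z in Metric.ball z₀ (s₀ - s), E (s, z) ≤ ∫ z in Metric.ball z₀ s₀, E (0, z) := by
  let χ : ℕ → ℝ → ℝ := fun n t => Real.smoothTransition (n * t)
  have hint : ∀ t, ∀ R, IntegrableOn (fun z => E (t, z)) (Metric.ball z₀ R) := fun t R =>
    ((hE.continuous.comp (by fun_prop : Continuous fun z : ℂ => (t, z))).locallyIntegrable.integrableOn_isCompact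
      (isCompact_closedBall z₀ R)).mono_set Metric.ball_subset_closedBall
  have hset : ∀ n : ℕ, ∀ t, t ≤ s₀ → ∫ z, χ n (coneFun z₀ s₀ (t, z)) * E (t, z)
      = ∫ z in Metric.ball z₀ (s₀ - t), χ n (coneFun z₀ s₀ (t, z)) * E (t, z) := by
    intro n t ht
    symm
    apply setIntegral_eq_integral_of_forall_compl_eq_zero
    intro z hz
    have : s₀ - t ≤ ‖z - z₀‖ := by simpa [dist_eq_norm] using hz
    have h2 : χ n (coneFun z₀ s₀ (t, z)) = 0 := by
      apply Real.smoothTransition.zero_of_nonpos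
      rw [coneFun_eq]
      apply mul_nonpos_of_nonneg_of_nonpos (by positivity)
      nlinarith
    simp [h2]
  have hmeas : ∀ n : ℕ, ∀ t, Continuous (fun z => χ n (coneFun z₀ s₀ (t, z)) * E (t, z)) := by
    intro n t
    have hsl : Continuous fun z : ℂ => (t, z) := by fun_prop
    refine Continuous.mul ?_ (hE.continuous.comp hsl)
    exact Real.smoothTransition.continuous.comp
      (continuous_const.mul ((coneFun_contDiff z₀ s₀).continuous.comp hsl))
  have hle : ∀ n : ℕ, ∫ z in Metric.ball z₀ (s₀ - s), χ n (coneFun z₀ s₀ (s, z)) * E (s, z)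
      ≤ ∫ z in Metric.ball z₀ s₀, E (0, z) := by
    intro n
    have := mono_cut E F₁ F₂ hE hF₁ hF₂ z₀ s₀ hE0 hdiv hF (χ n)
      (Real.smoothTransition.contDiff.comp (contDiff_const.mul contDiff_id))
      (fun a b hab => Real.smoothTransition.monotone (by gcongr))
      (fun t ht => Real.smoothTransition.zero_of_nonpos
        (mul_nonpos_of_nonneg_of_nonpos (by positivity) ht)) s hs hss
    rw [hset n s hss, hset n 0 (hs.trans hss), sub_zero] at this
    refine this.trans ?_
    apply integral_mono_of_nonneg
    · exact Filter.Eventually.of_forall fun z => mul_nonneg (Real.smoothTransition.nonneg _) (hE0 _)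
    · exact hint 0 s₀
    · exact Filter.Eventually.of_forall fun z =>
        mul_le_of_le_one_left (hE0 _) (Real.smoothTransition.le_one _)
  refine le_of_tendsto (f := fun n : ℕ => ∫ z in Metric.ball z₀ (s₀ - s), χ n (coneFun z₀ s₀ (s, z)) * E (s, z)) (x := Filter.atTop) ?_ (Filter.Eventually.of_forall hle)
  apply tendsto_integral_of_dominated_convergence (fun z => E (s, z))
  · exact fun n => (hmeas n s).aestronglyMeasurable
  · exact hint s _
  · intro n
    refine Filter.Eventually.of_forall fun z => ?_
    rw [Real.norm_of_nonneg (mul_nonneg (Real.smoothTransition.nonneg _) (hE0 _))]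
    exact mul_le_of_le_one_left (hE0 _) (Real.smoothTransition.le_one _)
  · filter_upwards [ae_restrict_mem Metric.isOpen_ball.measurableSet] with z hz
    have hz' : ‖z - z₀‖ < s₀ - s := by simpa [dist_eq_norm] using hz
    have hpos : 0 < coneFun z₀ s₀ (s, z) := by
      rw [coneFun_eq]
      nlinarith [norm_nonneg (z - z₀)]
    apply tendsto_const_nhds.congr'
    obtain ⟨N, hN⟩ := exists_nat_gt (1 / coneFun z₀ s₀ (s, z))
    filter_upwards [Filter.eventually_ge_atTop N] with n hn
    have : (1:ℝ) ≤ n * coneFun z₀ s₀ (s, z) := by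
      rw [div_lt_iff₀ hpos] at hN
      have : (N:ℝ) ≤ n := by exact_mod_cast hn
      nlinarith
    simp [χ, Real.smoothTransition.one_of_one_le this]

open scoped Manifold ContDiff in
lemma exists_bump (K U : Set (ℝ × ℂ)) (hK : IsClosed K) (hU : IsOpen U) (hKU : K ⊆ U) :
    ∃ η : ℝ × ℂ → ℝ, ContDiff ℝ 1 η ∧ (∀ q ∈ K, ∀ᶠ x in nhds q, η x = 1) ∧ (∀ x, 0 ≤ η x) ∧
      ∀ G : ℝ × ℂ → ℝ, ContDiffOn ℝ 1 G U → ContDiff ℝ 1 (fun q => η q * G q) := by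
  obtain ⟨V, hV, hKV, hVU⟩ := normal_exists_closure_subset hK hU hKU
  obtain ⟨f, h1, h0, h2⟩ := exists_contMDiffMap_one_nhds_of_subset_interior (n := 1) 𝓘(ℝ, ℝ × ℂ)
    (s := K) (t := V) hK (by rwa [hV.interior_eq])
  have hf : ContDiff ℝ 1 f := f.contMDiff.contDiff
  refine ⟨f, hf, ?_, fun x => (h2 x).1, ?_⟩
  · intro q hq
    exact (eventually_nhdsSet_iff_forall.1 h1) q hq
  · intro G hG
    rw [contDiff_iff_contDiffAt]
    intro x
    by_cases hx : x ∈ U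
    · exact hf.contDiffAt.mul (hG.contDiffAt (hU.mem_nhds hx))
    · have : (fun q => f q * G q) =ᶠ[nhds x] fun _ => 0 := by
        filter_upwards [isClosed_closure.isOpen_compl.mem_nhds (fun h => hx (hVU h))] with q hq
        rw [h0 q (fun h => hq (subset_closure h)), zero_mul]
      exact contDiffAt_const.congr_of_eventuallyEq this

lemma energy_local (E F₁ F₂ : ℝ × ℂ → ℝ) (U : Set (ℝ × ℂ)) (hU : IsOpen U)
    (hE : ContDiffOn ℝ 1 E U) (hF₁ : ContDiffOn ℝ 1 F₁ U)
    (hF₂ : ContDiffOn ℝ 1 F₂ U) (z₀ : ℂ) (s₀ : ℝ)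
    (hcone : {q : ℝ × ℂ | 0 ≤ q.1 ∧ q.1 ≤ s₀ ∧ dist q.2 z₀ ≤ s₀ - q.1} ⊆ U)
    (hE0 : ∀ q, 0 ≤ E q)
    (hdiv : ∀ q ∈ U,
      fderiv ℝ E q (1, 0) = fderiv ℝ F₁ q (0, 1) + fderiv ℝ F₂ q (0, I))
    (hF : ∀ q, F₁ q ^ 2 + F₂ q ^ 2 ≤ E q ^ 2)
    (s : ℝ) (hs : 0 ≤ s) (hss : s ≤ s₀) :
    ∫ z in Metric.ball z₀ (s₀ - s), E (s, z) ≤ ∫ z in Metric.ball z₀ s₀, E (0, z) := by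
  have hKc : IsClosed {q : ℝ × ℂ | 0 ≤ q.1 ∧ q.1 ≤ s₀ ∧ dist q.2 z₀ ≤ s₀ - q.1} := by
    have a1 : IsClosed {q : ℝ × ℂ | 0 ≤ q.1} := isClosed_le (by fun_prop) (by fun_prop)
    have a2 : IsClosed {q : ℝ × ℂ | q.1 ≤ s₀} := isClosed_le (by fun_prop) (by fun_prop)
    have a3 : IsClosed {q : ℝ × ℂ | dist q.2 z₀ ≤ s₀ - q.1} :=
      isClosed_le (by fun_prop) (by fun_prop)
    exact a1.inter (a2.inter a3)
  obtain ⟨η, hη, h1, hη0, hext⟩ := exists_bump _ U hKc hU hcone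
  have hev : ∀ s z, 0 ≤ s → s ≤ s₀ → ‖z - z₀‖ ≤ s₀ - s → ∀ G : ℝ × ℂ → ℝ,
      (fun q => η q * G q) =ᶠ[nhds (s, z)] G := by
    intro s z a b c G
    filter_upwards [h1 (s, z) ⟨a, b, by simpa [dist_eq_norm] using c⟩] with q hq
    rw [hq, one_mul]
  have key := energy_global _ _ _ (hext E hE) (hext F₁ hF₁) (hext F₂ hF₂) z₀ s₀
    (fun q => mul_nonneg (hη0 q) (hE0 q))
    (fun s z a b c => by
      rw [(hev s z a b c E).fderiv_eq, (hev s z a b c F₁).fderiv_eq, (hev s z a b c F₂).fderiv_eq]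
      exact hdiv _ (hcone ⟨a, b, by simpa [dist_eq_norm] using c⟩))
    (fun s z a b c => by
      have := mul_le_mul_of_nonneg_left (hF (s, z)) (sq_nonneg (η (s, z)))
      nlinarith) s hs hss
  have hI : ∀ t, 0 ≤ t → t ≤ s₀ → ∫ z in Metric.ball z₀ (s₀ - t), η (t, z) * E (t, z)
      = ∫ z in Metric.ball z₀ (s₀ - t), E (t, z) := by
    intro t a b
    apply setIntegral_congr_fun Metric.isOpen_ball.measurableSet
    intro z hz
    have hz' : ‖z - z₀‖ < s₀ - t := by simpa [dist_eq_norm] using hz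
    exact (hev t z a b hz'.le E).eq_of_nhds
  have h00 := hI 0 le_rfl (hs.trans hss)
  rw [sub_zero] at h00
  rwa [hI s hs hss, h00] at key

lemma div_identity (v w : ℝ × ℂ → ℂ) (q : ℝ × ℂ) (hv : DifferentiableAt ℝ v q)
    (hw : DifferentiableAt ℝ w q) (τ p₁ p₂ : ℝ)
    (e1 : fderiv ℝ v q (1, 0) = (1 / 2 : ℂ) * (fderiv ℝ w q (0, 1) - I * fderiv ℝ w q (0, I))
      - τ * ((1 / 2 : ℂ) * (p₁ - I * p₂)) * w q)
    (e2 : fderiv ℝ w q (1, 0) = (1 / 2 : ℂ) * (fderiv ℝ v q (0, 1) + I * fderiv ℝ v q (0, I))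
      + τ * ((1 / 2 : ℂ) * (p₁ + I * p₂)) * v q) :
    fderiv ℝ (fun q => ‖v q‖ ^ 2 + ‖w q‖ ^ 2) q (1, 0)
      = fderiv ℝ (fun q => (w q).re * (v q).re + (w q).im * (v q).im) q (0, 1)
        + fderiv ℝ (fun q => (w q).im * (v q).re - (w q).re * (v q).im) q (0, I) := by
  have vr : HasFDerivAt (fun q => (v q).re) (Complex.reCLM.comp (fderiv ℝ v q)) q :=
    Complex.reCLM.hasFDerivAt.comp q hv.hasFDerivAt
  have vi : HasFDerivAt (fun q => (v q).im) (Complex.imCLM.comp (fderiv ℝ v q)) q :=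
    Complex.imCLM.hasFDerivAt.comp q hv.hasFDerivAt
  have wr : HasFDerivAt (fun q => (w q).re) (Complex.reCLM.comp (fderiv ℝ w q)) q :=
    Complex.reCLM.hasFDerivAt.comp q hw.hasFDerivAt
  have wi : HasFDerivAt (fun q => (w q).im) (Complex.imCLM.comp (fderiv ℝ w q)) q :=
    Complex.imCLM.hasFDerivAt.comp q hw.hasFDerivAt
  have hE : (fun q => ‖v q‖ ^ 2 + ‖w q‖ ^ 2) = fun q => ((v q).re * (v q).re + (v q).im * (v q).im)
      + ((w q).re * (w q).re + (w q).im * (w q).im) := by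
    funext q
    rw [Complex.sq_norm, Complex.sq_norm, Complex.normSq_apply, Complex.normSq_apply]
  have dE := (((vr.fun_mul vr).fun_add (vi.fun_mul vi)).fun_add ((wr.fun_mul wr).fun_add (wi.fun_mul wi))).fderiv
  have d1 := ((wr.fun_mul vr).fun_add (wi.fun_mul vi)).fderiv
  have d2 := ((wi.fun_mul vr).fun_sub (wr.fun_mul vi)).fderiv
  rw [hE, dE, d1, d2]
  have e1r := congrArg Complex.re e1
  have e1i := congrArg Complex.im e1
  have e2r := congrArg Complex.re e2
  have e2i := congrArg Complex.im e2
  simp at e1r e1i e2r e2i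
  simp
  linear_combination 2 * (v q).re * e1r + 2 * (v q).im * e1i + 2 * (w q).re * e2r + 2 * (w q).im * e2i

lemma poly_contDiff (p : ℂ → ℝ) (hp : IsRealPoly p) : ContDiff ℝ 2 p := by
  obtain ⟨P, hP⟩ := hp
  have : p = fun z => MvPolynomial.eval ![z.re, z.im] P := funext hP
  rw [this]
  clear this hP
  have hre : ContDiff ℝ 2 Complex.re := Complex.reCLM.contDiff
  have him : ContDiff ℝ 2 Complex.im := Complex.imCLM.contDiff
  induction P using MvPolynomial.induction_on with
  | C a => simpa using contDiff_const
  | add P Q h1 h2 => simpa using h1.add h2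
  | mul_X P i h =>
    simp only [map_mul, MvPolynomial.eval_X]
    refine h.mul ?_
    fin_cases i
    · simpa using hre
    · simpa using him

lemma pd_ofReal (p : ℂ → ℝ) (hp : ContDiff ℝ 2 p) (z h : ℂ) :
    fderiv ℝ (fun w => (p w : ℂ)) z h = ((fderiv ℝ p z h : ℝ) : ℂ) := by
  have := (Complex.ofRealCLM.hasFDerivAt.comp z
    (hp.differentiable (by norm_num) z).hasFDerivAt).fderiv
  have e : fderiv ℝ (fun w => (p w : ℂ)) z = _ := this
  rw [e]; simp


/-- Proposition `prop:energy2`: local conservation of energy. -/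
theorem statement12 (p : ℂ → ℝ) (hpoly : IsRealPoly p) (τ : ℝ)
    (z₀ : ℂ) (s₀ : ℝ) (hs₀ : 0 < s₀)
    (u : ℝ × ℂ → ℂ) (U : Set (ℝ × ℂ)) (hU : IsOpen U)
    (hcone : {q : ℝ × ℂ | 0 ≤ q.1 ∧ q.1 ≤ s₀ ∧ dist q.2 z₀ ≤ s₀ - q.1} ⊆ U)
    (hu : ContDiffOn ℝ 2 u U)
    (hwave : ∀ q ∈ U,
      timeDeriv (timeDeriv u) q + BoxT p τ (fun w => u (q.1, w)) q.2 = 0) :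
    ∀ s : ℝ, 0 ≤ s → s ≤ s₀ →
      (∫ w in Metric.ball z₀ (s₀ - s),
          ‖timeDeriv u (s, w)‖ ^ 2 + ‖Zb p τ (fun v => u (s, v)) w‖ ^ 2)
        ≤ ∫ w in Metric.ball z₀ s₀,
            ‖timeDeriv u (0, w)‖ ^ 2 + ‖Zb p τ (fun v => u (0, v)) w‖ ^ 2 := by
  intro s hs hss
  have hp := poly_contDiff p hpoly
  have huat : ∀ q ∈ U, ContDiffAt ℝ 2 u q := fun q hq => hu.contDiffAt (hU.mem_nhds hq)
  have hud : ∀ q ∈ U, DifferentiableAt ℝ u q := fun q hq => (huat q hq).differentiableAt (by norm_num)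
  have hDu : ∀ q ∈ U, ContDiffAt ℝ 1 (fderiv ℝ u) q := fun q hq =>
    (huat q hq).fderiv_right (by norm_num)
  set v : ℝ × ℂ → ℂ := timeDeriv u with hv
  set w : ℝ × ℂ → ℂ := fun q => Zb p τ (fun y => u (q.1, y)) q.2 with hw
  have hb : ∀ z, Wzb (fun w => (p w : ℂ)) z
      = (1 / 2 : ℂ) * ((fderiv ℝ p z 1 : ℝ) + I * (fderiv ℝ p z I : ℝ)) := by
    intro z
    simp only [Wzb, pd₁, pd₂, pd_ofReal p hp]
  have hc : ∀ z, Wz (fun w => (p w : ℂ)) z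
      = (1 / 2 : ℂ) * ((fderiv ℝ p z 1 : ℝ) - I * (fderiv ℝ p z I : ℝ)) := by
    intro z
    simp only [Wz, pd₁, pd₂, pd_ofReal p hp]
  let B : ℂ → ℂ := fun z => (1 / 2 : ℂ) * ((fderiv ℝ p z 1 : ℝ) + I * (fderiv ℝ p z I : ℝ))
  have hB : ContDiff ℝ 1 B := by
    have h1 : ContDiff ℝ 1 (fderiv ℝ p) := hp.fderiv_right (by norm_num)
    have h2 : ∀ h : ℂ, ContDiff ℝ 1 (fun z => ((fderiv ℝ p z h : ℝ) : ℂ)) := fun h =>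
      Complex.ofRealCLM.contDiff.comp (h1.clm_apply contDiff_const)
    exact contDiff_const.mul ((h2 1).add (contDiff_const.mul (h2 I)))
  let W : ℝ × ℂ → ℂ := fun q => (1 / 2 : ℂ) * (fderiv ℝ u q (0, 1) + I * fderiv ℝ u q (0, I))
    + τ * B q.2 * u q
  have hwW : ∀ q ∈ U, w q = W q := by
    intro q hq
    have h := (slice_fderiv u q.1 q.2 (hud q hq)).fderiv
    simp only [hw, Zb, hb]
    simp only [Wzb, pd₁, pd₂, h]
    simp [W, B]
  have hvat : ∀ q ∈ U, ContDiffAt ℝ 1 v q := fun q hq =>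
    (hDu q hq).clm_apply contDiffAt_const
  have hdu : ∀ q ∈ U, ∀ k, ContDiffAt ℝ 1 (fun q => fderiv ℝ u q k) q := fun q hq k =>
    (hDu q hq).clm_apply contDiffAt_const
  have hB2 : ContDiff ℝ 1 (fun q : ℝ × ℂ => B q.2) := hB.comp contDiff_snd
  have hweq : ∀ q ∈ U, w =ᶠ[nhds q] W := fun q hq => by
    filter_upwards [hU.mem_nhds hq] with x hx using hwW x hx
  have hwat : ∀ q ∈ U, ContDiffAt ℝ 1 w q := fun q hq => by
    refine ContDiffAt.congr_of_eventuallyEq ?_ (hweq q hq)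
    exact (contDiffAt_const.mul ((hdu q hq _).add (contDiffAt_const.mul (hdu q hq _)))).add
      ((contDiffAt_const.mul hB2.contDiffAt).mul ((huat q hq).of_le (by norm_num)))
  have hvd : ∀ q ∈ U, DifferentiableAt ℝ v q := fun q hq => (hvat q hq).differentiableAt (by norm_num)
  have hwd : ∀ q ∈ U, DifferentiableAt ℝ w q := fun q hq => (hwat q hq).differentiableAt (by norm_num)
  have e1 : ∀ q ∈ U, fderiv ℝ v q (1, 0)
      = (1 / 2 : ℂ) * (fderiv ℝ w q (0, 1) - I * fderiv ℝ w q (0, I))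
      - τ * ((1 / 2 : ℂ) * ((fderiv ℝ p q.2 1 : ℝ) - I * (fderiv ℝ p q.2 I : ℝ))) * w q := by
    intro q hq
    have h := hwave q hq
    have h2 : BoxT p τ (fun y => u (q.1, y)) q.2
        = -(Wz (fun z => w (q.1, z)) q.2 - τ * Wz (fun w => (p w : ℂ)) q.2 * w q) := rfl
    have h3 := (slice_fderiv w q.1 q.2 (hwd q hq)).fderiv
    rw [h2, hc] at h
    simp only [Wz, pd₁, pd₂, h3] at h
    simp only [ContinuousLinearMap.comp_apply, ContinuousLinearMap.inr_apply, Prod.mk.eta] at h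
    have h4 : timeDeriv v q = fderiv ℝ v q (1, 0) := rfl
    rw [h4] at h
    linear_combination h
  have e2 : ∀ q ∈ U, fderiv ℝ w q (1, 0)
      = (1 / 2 : ℂ) * (fderiv ℝ v q (0, 1) + I * fderiv ℝ v q (0, I))
      + τ * ((1 / 2 : ℂ) * ((fderiv ℝ p q.2 1 : ℝ) + I * (fderiv ℝ p q.2 I : ℝ))) * v q := by
    intro q hq
    have hsym : IsSymmSndFDerivAt ℝ u q := (huat q hq).isSymmSndFDerivAt (by simp)
    have hDD : DifferentiableAt ℝ (fderiv ℝ u) q := (hDu q hq).differentiableAt (by norm_num)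
    have happ : ∀ k, HasFDerivAt (fun q => fderiv ℝ u q k)
        ((ContinuousLinearMap.apply ℝ ℂ k).comp (fderiv ℝ (fderiv ℝ u) q)) q := fun k =>
      (ContinuousLinearMap.apply ℝ ℂ k).hasFDerivAt.comp q hDD.hasFDerivAt
    have hvf : ∀ k, fderiv ℝ v q k = fderiv ℝ (fderiv ℝ u) q (1, 0) k := by
      intro k
      have : fderiv ℝ v q = _ := (happ (1, 0)).fderiv
      rw [this, ← hsym.eq]; simp
    have hB3 := (hB2.differentiable (by norm_num) q).hasFDerivAt
    have hBz : fderiv ℝ (fun q : ℝ × ℂ => B q.2) q (1, 0) = 0 := by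
      have : fderiv ℝ (fun q : ℝ × ℂ => B q.2) q = _ :=
        (((hB.differentiable (by norm_num) q.2).hasFDerivAt).comp q
          (hasFDerivAt_snd (𝕜 := ℝ) (p := q))).fderiv
      rw [this]; simp
    rw [(hweq q hq).fderiv_eq, hvf, hvf]
    have hWd : fderiv ℝ W q = _ := ((((happ (0, 1)).fun_add
      ((happ (0, I)).const_mul I)).const_mul (1 / 2 : ℂ)).fun_add
      ((hB3.const_mul (τ : ℂ)).fun_mul (hud q hq).hasFDerivAt)).fderiv
    rw [hWd]
    simp [hBz, hv, timeDeriv]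
    simp [B]
    ring
  have hE : ContDiffOn ℝ 1 (fun q => ‖v q‖ ^ 2 + ‖w q‖ ^ 2) U := fun q hq =>
    (((hvat q hq).norm_sq ℝ).add ((hwat q hq).norm_sq ℝ)).contDiffWithinAt
  have hre : ∀ f : ℝ × ℂ → ℂ, ∀ q, ContDiffAt ℝ 1 f q → ContDiffAt ℝ 1 (fun q => (f q).re) q :=
    fun f q hf => Complex.reCLM.contDiff.contDiffAt.comp q hf
  have him : ∀ f : ℝ × ℂ → ℂ, ∀ q, ContDiffAt ℝ 1 f q → ContDiffAt ℝ 1 (fun q => (f q).im) q :=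
    fun f q hf => Complex.imCLM.contDiff.contDiffAt.comp q hf
  have hF₁ : ContDiffOn ℝ 1 (fun q => (w q).re * (v q).re + (w q).im * (v q).im) U := fun q hq =>
    (((hre w q (hwat q hq)).mul (hre v q (hvat q hq))).add
      ((him w q (hwat q hq)).mul (him v q (hvat q hq)))).contDiffWithinAt
  have hF₂ : ContDiffOn ℝ 1 (fun q => (w q).im * (v q).re - (w q).re * (v q).im) U := fun q hq =>
    (((him w q (hwat q hq)).mul (hre v q (hvat q hq))).sub
      ((hre w q (hwat q hq)).mul (him v q (hvat q hq)))).contDiffWithinAt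
  exact energy_local (fun q => ‖v q‖ ^ 2 + ‖w q‖ ^ 2)
    (fun q => (w q).re * (v q).re + (w q).im * (v q).im)
    (fun q => (w q).im * (v q).re - (w q).re * (v q).im) U hU hE hF₁ hF₂ z₀ s₀ hcone
    (fun q => by positivity)
    (fun q hq => div_identity v w q (hvd q hq) (hwd q hq) τ _ _ (e1 q hq) (e2 q hq))
    (fun q => by
      have h1 : ‖v q‖ ^ 2 = (v q).re ^ 2 + (v q).im ^ 2 := by
        rw [Complex.sq_norm, Complex.normSq_apply]; ring
      have h2 : ‖w q‖ ^ 2 = (w q).re ^ 2 + (w q).im ^ 2 := by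
        rw [Complex.sq_norm, Complex.normSq_apply]; ring
      have h3 : ((w q).re * (v q).re + (w q).im * (v q).im) ^ 2
          + ((w q).im * (v q).re - (w q).re * (v q).im) ^ 2 = ‖v q‖ ^ 2 * ‖w q‖ ^ 2 := by
        rw [h1, h2]; ring
      rw [h3]
      nlinarith [sq_nonneg (‖v q‖ ^ 2), sq_nonneg (‖w q‖ ^ 2), sq_nonneg (‖v q‖ * ‖w q‖)])
    s hs hss

end
end
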